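/- arXiv:1812.03036 — 2 statements merged into one kernel-verified Lean document; each statement's English description precedes it below -/
import Mathlib

section
/- Let c > 1 be a non-integer real number and η > 0. Then uniformly for all real U with |U| ≥ η and all N ≥ 1, |∑_{n≤N} e(U·n^c)| ≪ |U|·N^{1 − ‖c‖/2^c}, where ‖c‖ is the distance from c to the nearest integer and e(u) = exp(2πiu), with implied constant depending only on c and η. -/
namespace VdC

/-- the additive character -/
noncomputable def ee (x : ℝ) : ℂ := Complex.exp (2 * Real.pi * Complex.I * (x : ℂ))

/-- forward difference -/
def D (f : ℕ → ℝ) : ℕ → ℝ := fun n => f (n + 1) - f n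

lemma ee_eq (x : ℝ) : ee x = Complex.exp (((2 * Real.pi * x : ℝ) : ℂ) * Complex.I) := by
  unfold ee; congr 1; push_cast; ring

lemma norm_ee (x : ℝ) : ‖ee x‖ = 1 := by
  rw [ee_eq, Complex.norm_exp_ofReal_mul_I]

lemma ee_add (x y : ℝ) : ee (x + y) = ee x * ee y := by
  unfold ee; rw [← Complex.exp_add]; congr 1; push_cast; ring

lemma ee_neg (x : ℝ) : ee (-x) = (starRingEnd ℂ) (ee x) := by
  rw [ee_eq, ee_eq, ← Complex.exp_conj]; congr 1
  rw [map_mul, Complex.conj_ofReal, Complex.conj_I]; push_cast; ring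

lemma ee_int (n : ℤ) : ee n = 1 := by
  unfold ee
  rw [Complex.exp_eq_one_iff]
  exact ⟨n, by push_cast; ring⟩

lemma ee_sub (x y : ℝ) : ee (x - y) = ee x * (starRingEnd ℂ) (ee y) := by
  rw [sub_eq_add_neg, ee_add, ee_neg]

lemma norm_sum_le (f : ℕ → ℝ) (s : Finset ℕ) : ‖∑ n ∈ s, ee (f n)‖ ≤ s.card := by
  refine (_root_.norm_sum_le _ _).trans ?_
  simp [norm_ee]

/-- the kernel in the Kusmin-Landau argument -/
noncomputable def tt (u : ℝ) : ℝ := Real.cos (Real.pi * u) / Real.sin (Real.pi * u) / 2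
noncomputable def GG (u : ℝ) : ℂ := -1/2 - Complex.I * (tt u : ℂ)

lemma GG_mul (u : ℝ) (h : Real.sin (Real.pi * u) ≠ 0) : (ee u - 1) * GG u = 1 := by
  have h1 : ee u = ((Real.cos (Real.pi * u) : ℂ) + Real.sin (Real.pi * u) * Complex.I) ^ 2 := by
    have : ee u = (Complex.exp (((Real.pi * u : ℝ) : ℂ) * Complex.I)) ^ 2 := by
      rw [ee_eq, ← Complex.exp_nat_mul]; congr 1; push_cast; ring
    rw [this, Complex.exp_mul_I, Complex.ofReal_cos, Complex.ofReal_sin]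
  rw [h1, GG, tt]
  have h2 := Real.sin_sq_add_cos_sq (Real.pi * u)
  set s := Real.sin (Real.pi * u)
  set c := Real.cos (Real.pi * u)
  have hs : (s : ℂ) ≠ 0 := by exact_mod_cast h
  have h3 : (s : ℂ) ^ 2 + (c : ℂ) ^ 2 = 1 := by exact_mod_cast h2
  have hI := Complex.I_sq
  push_cast
  field_simp
  have e1 : ((c : ℂ) + s * Complex.I) ^ 2 - 1 = 2 * s * Complex.I * (c + s * Complex.I) := by
    linear_combination h3 - (s : ℂ) ^ 2 * hI
  rw [e1]
  linear_combination (-2 * (s : ℂ) * (s ^ 2 + c ^ 2) ) * hI + 2 * s * h3 -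
    2 * (s : ℂ) ^ 2 * c * Complex.I * hI

lemma sin_lower (D u : ℝ) (hD : 0 < D) (h1 : D ≤ u) (h2 : u ≤ 1 - D) :
    2 * D ≤ Real.sin (Real.pi * u) := by
  have hp := Real.pi_pos
  rcases le_total u (1/2) with h | h
  · have := Real.mul_le_sin (x := Real.pi * u) (by nlinarith) (by nlinarith)
    have e : 2 / Real.pi * (Real.pi * u) = 2 * u := by field_simp
    linarith
  · have := Real.mul_le_sin (x := Real.pi * (1 - u)) (by nlinarith) (by nlinarith)
    have e : 2 / Real.pi * (Real.pi * (1 - u)) = 2 * (1 - u) := by field_simp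
    have e2 : Real.sin (Real.pi * (1 - u)) = Real.sin (Real.pi * u) := by
      rw [mul_sub, mul_one, Real.sin_pi_sub]
    linarith

lemma tt_bound (D u : ℝ) (hD : 0 < D) (h1 : D ≤ u) (h2 : u ≤ 1 - D) : |tt u| ≤ 1 / (4 * D) := by
  have := sin_lower D u hD h1 h2
  rw [tt, abs_div, abs_div, abs_of_pos (show (0:ℝ) < Real.sin (Real.pi * u) by linarith)]
  have hc := Real.abs_cos_le_one (Real.pi * u)
  rw [abs_of_pos (by norm_num : (0:ℝ) < 2), div_div]
  apply div_le_div₀ <;> linarith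

lemma tt_anti (D u v : ℝ) (hD : 0 < D) (h1 : D ≤ u) (huv : u ≤ v) (h2 : v ≤ 1 - D) :
    tt v ≤ tt u := by
  have hu := sin_lower D u hD h1 (by linarith)
  have hv := sin_lower D v hD (by linarith) h2
  have hp := Real.pi_pos
  have hs : 0 ≤ Real.sin (Real.pi * v - Real.pi * u) := by
    apply Real.sin_nonneg_of_nonneg_of_le_pi <;> nlinarith
  rw [Real.sin_sub] at hs
  unfold tt
  have : Real.cos (Real.pi * v) / Real.sin (Real.pi * v) ≤
      Real.cos (Real.pi * u) / Real.sin (Real.pi * u) := by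
    rw [div_le_div_iff₀ (by linarith) (by linarith)]
    linarith
  linarith

lemma abel (z g : ℕ → ℂ) (t : ℕ → ℝ) (hz : ∀ n, ‖z n‖ = 1) (L : ℕ)
    (hg : ∀ n < L, ‖g n - g (n + 1)‖ ≤ t n - t (n + 1)) :
    ‖∑ n ∈ Finset.range (L + 1), (z (n + 1) - z n) * g n - z (L + 1) * g L‖
      ≤ ‖g 0‖ + (t 0 - t L) := by
  induction L with
  | zero => simp [sub_mul, hz]
  | succ L ih =>
    have := ih (fun n hn => hg n (by omega))
    rw [Finset.sum_range_succ]
    have e : ∑ n ∈ Finset.range (L + 1), (z (n + 1) - z n) * g n +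
        (z (L + 1 + 1) - z (L + 1)) * g (L + 1) - z (L + 1 + 1) * g (L + 1)
      = (∑ n ∈ Finset.range (L + 1), (z (n + 1) - z n) * g n - z (L + 1) * g L)
        + z (L + 1) * (g L - g (L + 1)) := by ring
    rw [e]
    refine (norm_add_le _ _).trans ?_
    rw [norm_mul, hz, one_mul]
    have := hg L (by omega)
    linarith

lemma kl (f : ℕ → ℝ) (L : ℕ) (d : ℝ) (hd : 0 < d) (ν : ℤ)
    (hmono : ∀ n, n + 1 < L → D f n ≤ D f (n + 1))
    (h : ∀ n < L, ν + d ≤ D f n ∧ D f n ≤ ν + 1 - d) :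
    ‖∑ n ∈ Finset.range L, ee (f n)‖ ≤ 2 / d := by
  rcases L with _ | L
  · simp; positivity
  set u : ℕ → ℝ := fun n => D f n - ν with hu
  have hu1 : ∀ n < L + 1, d ≤ u n ∧ u n ≤ 1 - d := fun n hn => by
    have := h n hn; simp only [hu]; constructor <;> linarith
  have hd2 : d ≤ 1 / 2 := by have := hu1 0 (by omega); linarith
  have key : ∀ n ∈ Finset.range (L + 1), ee (f n) = (ee (f (n + 1)) - ee (f n)) * GG (u n) := by
    intro n hn
    have hn := hu1 n (Finset.mem_range.mp hn)
    have hs := sin_lower d (u n) hd hn.1 hn.2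
    have h1 := GG_mul (u n) (by linarith)
    have h2 : ee (f (n + 1)) = ee (f n) * ee (u n) := by
      have : f (n + 1) = f n + u n + (ν : ℤ) := by simp only [hu, D]; ring
      rw [this, ee_add, ee_int, ee_add, mul_one]
    rw [h2]
    linear_combination (-ee (f n)) * h1
  rw [Finset.sum_congr rfl key]
  have hG : ∀ n < L + 1, ‖GG (u n)‖ ≤ 1 / (2 * d) := by
    intro n hn
    have hn := hu1 n hn
    have := tt_bound d (u n) hd hn.1 hn.2
    unfold GG
    refine (norm_sub_le _ _).trans ?_
    rw [norm_mul, Complex.norm_I, one_mul, Complex.norm_real, Real.norm_eq_abs]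
    have : ‖(-1 / 2 : ℂ)‖ = 1 / 2 := by simp
    have h4 : (1:ℝ) / (2 * d) = 1 / (4 * d) + 1 / (4 * d) := by field_simp; norm_num
    have h5 : (1:ℝ) / 2 ≤ 1 / (4 * d) := by
      apply one_div_le_one_div_of_le <;> linarith
    linarith
  have ha := abel (fun n => ee (f n)) (fun n => GG (u n)) (fun n => tt (u n))
    (fun n => norm_ee _) L (by
      intro n hn
      have := tt_anti d (u n) (u (n + 1)) hd (hu1 n (by omega)).1
        (by have := hmono n (by omega); simp only [hu]; linarith) (hu1 (n + 1) (by omega)).2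
      have e : GG (u n) - GG (u (n + 1)) = - Complex.I * ((tt (u n) - tt (u (n + 1)) : ℝ) : ℂ) := by
        unfold GG; push_cast; ring
      rw [e, norm_mul, norm_neg, Complex.norm_I, one_mul, Complex.norm_real, Real.norm_eq_abs,
        abs_of_nonneg (by linarith)])
  have h0 := hG 0 (by omega)
  have hL := hG L (by omega)
  have t0 := abs_le.mp (tt_bound d (u 0) hd (hu1 0 (by omega)).1 (hu1 0 (by omega)).2)
  have tL := abs_le.mp (tt_bound d (u L) hd (hu1 L (by omega)).1 (hu1 L (by omega)).2)
  set S := ∑ n ∈ Finset.range (L + 1), (ee (f (n + 1)) - ee (f n)) * GG (u n)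
  have e : S = (S - ee (f (L + 1)) * GG (u L)) + ee (f (L + 1)) * GG (u L) := by ring
  rw [e]
  refine (norm_add_le _ _).trans ?_
  rw [norm_mul, norm_ee, one_mul]
  have e1 : (2:ℝ) / d = 4 * (1 / (2 * d)) := by field_simp; norm_num
  have e2 : (1:ℝ) / (2 * d) = 2 * (1 / (4 * d)) := by field_simp; norm_num
  have : 0 < 1 / (4 * d) := by positivity
  linarith

lemma ordconn (s : Finset ℕ) (hs : s.Nonempty)
    (h : ∀ a ∈ s, ∀ b ∈ s, ∀ x, a ≤ x → x ≤ b → x ∈ s) :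
    s = Finset.Ico (s.min' hs) (s.max' hs + 1) := by
  ext x
  rw [Finset.mem_Ico]
  constructor
  · intro hx
    exact ⟨s.min'_le x hx, Nat.lt_succ_of_le (s.le_max' x hx)⟩
  · rintro ⟨h1, h2⟩
    exact h _ (s.min'_mem hs) _ (s.max'_mem hs) x h1 (by omega)

lemma diff_bounds (g : ℕ → ℝ) (N : ℕ) (l A : ℝ) (h : ∀ n < N, l ≤ D g n ∧ D g n ≤ A * l)
    (a m : ℕ) (hm : a + m ≤ N) :
    m * l ≤ g (a + m) - g a ∧ g (a + m) - g a ≤ m * (A * l) := by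
  induction m with
  | zero => simp
  | succ m ih =>
    have := ih (by omega)
    have h2 := h (a + m) (by omega)
    unfold D at h2
    push_cast
    rw [← add_assoc]
    constructor <;> linarith

lemma count (g : ℕ → ℝ) (N : ℕ) (l A w : ℝ) (hl : 0 < l) (hw : 0 ≤ w)
    (h : ∀ n < N, l ≤ D g n ∧ D g n ≤ A * l)
    (s : Finset ℕ) (hsN : ∀ a ∈ s, a < N) (hs : ∀ a ∈ s, ∀ b ∈ s, g b - g a ≤ w) :
    (s.card : ℝ) ≤ w / l + 1 := by
  rcases s.eq_empty_or_nonempty with rfl | hne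
  · simp; positivity
  set a := s.min' hne
  set b := s.max' hne
  have hab : a ≤ b := s.min'_le _ (s.max'_mem hne)
  have hsub : s ⊆ Finset.Icc a b := fun x hx => Finset.mem_Icc.mpr ⟨s.min'_le x hx, s.le_max' x hx⟩
  have hc := Finset.card_le_card hsub
  rw [Nat.card_Icc] at hc
  obtain ⟨m, hm⟩ := Nat.exists_eq_add_of_le hab
  have h1 := (diff_bounds g N l A h a m (by have := hsN b (s.max'_mem hne); omega)).1
  rw [← hm] at h1
  have h2 := hs a (s.min'_mem hne) b (s.max'_mem hne)
  have : (m : ℝ) ≤ w / l := by rw [le_div_iff₀ hl]; linarith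
  have h3 : (s.card : ℝ) ≤ m + 1 := by exact_mod_cast (by omega : s.card ≤ m + 1)
  linarith

lemma mono_of (g : ℕ → ℝ) (N : ℕ) (l A : ℝ) (hl : 0 < l)
    (h : ∀ n < N, l ≤ D g n ∧ D g n ≤ A * l) (a b : ℕ) (hab : a ≤ b) (hb : b ≤ N) : g a ≤ g b := by
  obtain ⟨m, rfl⟩ := Nat.exists_eq_add_of_le hab
  have := (diff_bounds g N l A h a m hb).1
  have : 0 ≤ m * l := by positivity
  linarith

lemma mid (f : ℕ → ℝ) (N : ℕ) (l A d : ℝ) (hl : 0 < l) (hd : 0 < d) (ν : ℤ)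
    (h : ∀ n < N, l ≤ D (D f) n ∧ D (D f) n ≤ A * l) (s : Finset ℕ)
    (hs : ∀ n, n ∈ s ↔ n < N ∧ ν + d ≤ D f n ∧ D f n ≤ ν + 1 - d) :
    ‖∑ n ∈ s, ee (f n)‖ ≤ 2 / d := by
  rcases s.eq_empty_or_nonempty with rfl | hne
  · simp; positivity
  have ho := ordconn s hne (by
    intro a ha b hb x hax hxb
    rw [hs] at *
    have h1 := mono_of (D f) N l A hl h a x hax (by omega)
    have h2 := mono_of (D f) N l A hl h x b hxb (by omega)
    refine ⟨by omega, by linarith, by linarith⟩)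
  generalize s.min' hne = a at ho
  generalize s.max' hne + 1 = b at ho
  subst ho
  rw [Finset.sum_Ico_eq_sum_range]
  have hmem : ∀ n < b - a, a + n < N ∧ ν + d ≤ D f (a + n) ∧ D f (a + n) ≤ ν + 1 - d := by
    intro n hn
    rw [← hs, Finset.mem_Ico]; omega
  exact kl (fun n => f (a + n)) (b - a) d hd ν (by
    intro n hn
    exact mono_of (D f) N l A hl h (a + n) (a + (n + 1)) (by omega) (hmem _ hn).1.le)
    (fun n hn => (hmem n hn).2)

lemma fiber (f : ℕ → ℝ) (N : ℕ) (l A : ℝ) (hl : 0 < l) (hl1 : l ≤ 1) (ν : ℤ)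
    (h : ∀ n < N, l ≤ D (D f) n ∧ D (D f) n ≤ A * l) :
    ‖∑ n ∈ (Finset.range N).filter (fun n => ⌊D f n⌋ = ν), ee (f n)‖ ≤ 6 / √l := by
  set d := √l with hd
  have hd0 : 0 < d := Real.sqrt_pos.mpr hl
  have hdd : d * d = l := Real.mul_self_sqrt hl.le
  have hd1 : d ≤ 1 := by nlinarith
  set s := (Finset.range N).filter (fun n => ⌊D f n⌋ = ν) with hs
  have hsm : ∀ n, n ∈ s → n < N ∧ ν ≤ D f n ∧ D f n < ν + 1 := by
    intro n hn
    rw [hs, Finset.mem_filter, Finset.mem_range, Int.floor_eq_iff] at hn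
    exact hn
  rw [← Finset.sum_filter_add_sum_filter_not s (fun n => D f n < ν + d),
    ← Finset.sum_filter_add_sum_filter_not (s.filter (fun n => ¬ D f n < ν + d))
      (fun n => ν + 1 - d < D f n)]
  have hdl : d / l = 1 / d := by rw [← hdd]; field_simp
  have b1 : ‖∑ n ∈ s.filter (fun n => D f n < ν + d), ee (f n)‖ ≤ 1 / d + 1 := by
    refine (norm_sum_le _ _).trans ?_
    rw [← hdl]
    refine count (D f) N l A d hl hd0.le h _ ?_ ?_
    · intro a ha; exact (hsm a (Finset.mem_filter.mp ha).1).1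
    · intro a ha b hb
      rw [Finset.mem_filter] at ha hb
      have := hsm a ha.1
      linarith [hb.2]
  have b2 : ‖∑ n ∈ (s.filter (fun n => ¬ D f n < ν + d)).filter (fun n => ν + 1 - d < D f n),
      ee (f n)‖ ≤ 1 / d + 1 := by
    refine (norm_sum_le _ _).trans ?_
    rw [← hdl]
    refine count (D f) N l A d hl hd0.le h _ ?_ ?_
    · intro a ha; exact (hsm a (Finset.mem_filter.mp (Finset.mem_filter.mp ha).1).1).1
    · intro a ha b hb
      rw [Finset.mem_filter, Finset.mem_filter] at ha hb
      have := hsm b hb.1.1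
      linarith [ha.2]
  have b3 : ‖∑ n ∈ (s.filter (fun n => ¬ D f n < ν + d)).filter (fun n => ¬ ν + 1 - d < D f n),
      ee (f n)‖ ≤ 2 / d := by
    refine mid f N l A d hl hd0 ν h _ ?_
    intro n
    rw [Finset.mem_filter, Finset.mem_filter, hs, Finset.mem_filter, Finset.mem_range,
      Int.floor_eq_iff, not_lt, not_lt]
    constructor
    · rintro ⟨⟨⟨h1, h2⟩, h3⟩, h4⟩; exact ⟨h1, h3, h4⟩
    · rintro ⟨h1, h3, h4⟩; exact ⟨⟨⟨h1, by linarith, by linarith⟩, h3⟩, h4⟩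
  refine (norm_add_le _ _).trans ?_
  have b4 := norm_add_le (∑ n ∈ (s.filter (fun n => ¬ D f n < ν + d)).filter
      (fun n => ν + 1 - d < D f n), ee (f n))
      (∑ n ∈ (s.filter (fun n => ¬ D f n < ν + d)).filter (fun n => ¬ ν + 1 - d < D f n), ee (f n))
  have b5 : 1 ≤ 1 / d := by rw [le_div_iff₀ hd0]; linarith
  have e1 : 2 / d = 2 * (1 / d) := by ring
  have e2 : 6 / d = 6 * (1 / d) := by ring
  linarith

/-- The k-th derivative bound -/
def P (k : ℕ) (κ σ : ℝ) : Prop := ∀ A : ℝ, ∃ C : ℝ, 0 ≤ C ∧ ∀ (f : ℕ → ℝ) (N : ℕ) (l : ℝ), 0 < l →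
  (∀ n < N, l ≤ D^[k] f n ∧ D^[k] f n ≤ A * l) →
  ‖∑ n ∈ Finset.range N, ee (f n)‖ ≤ C * (N * l ^ κ + (N : ℝ) ^ (1 - σ) * l ^ (-κ))

lemma triv (f : ℕ → ℝ) (N : ℕ) (l κ : ℝ) (hκ : 0 ≤ κ) (hl : 1 ≤ l) :
    ‖∑ n ∈ Finset.range N, ee (f n)‖ ≤ N * l ^ κ := by
  have h1 := norm_sum_le f (Finset.range N)
  rw [Finset.card_range] at h1
  have h2 := Real.one_le_rpow hl hκ
  have : (0:ℝ) ≤ N := by positivity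
  nlinarith

lemma P2 : P 2 (1/2) 1 := by
  intro A
  refine ⟨6 * |A| + 12, by positivity, ?_⟩
  intro f N l hl h
  have hA := abs_nonneg A
  have hp : 0 ≤ (N : ℝ) ^ (1 - 1 : ℝ) * l ^ (-(1/2) : ℝ) := by positivity
  have hp2 : 0 ≤ (N : ℝ) * l ^ ((1/2) : ℝ) := by positivity
  rcases le_total 1 l with hl1 | hl1
  · have := triv f N l (1/2) (by norm_num) hl1
    nlinarith
  rcases Nat.eq_zero_or_pos N with rfl | hN
  · simp only [Finset.range_zero, Finset.sum_empty, norm_zero]; positivity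
  have h' : ∀ n < N, l ≤ D (D f) n ∧ D (D f) n ≤ A * l := h
  rw [Real.rpow_neg hl.le, ← Real.sqrt_eq_rpow, sub_self, Real.rpow_zero, one_mul] at *
  have hmaps : ∀ n ∈ Finset.range N, ⌊D f n⌋ ∈ Finset.Icc ⌊D f 0⌋ ⌊D f (N - 1)⌋ := by
    intro n hn
    rw [Finset.mem_range] at hn
    rw [Finset.mem_Icc]
    exact ⟨Int.floor_mono (mono_of _ N l A hl h' 0 n (by omega) (by omega)),
      Int.floor_mono (mono_of _ N l A hl h' n (N-1) (by omega) (by omega))⟩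
  rw [← Finset.sum_fiberwise_of_maps_to hmaps]
  refine (_root_.norm_sum_le _ _).trans ?_
  refine (Finset.sum_le_sum (fun ν _ => fiber f N l A hl hl1 ν h')).trans ?_
  rw [Finset.sum_const, nsmul_eq_mul, Int.card_Icc]
  have hd := (diff_bounds (D f) N l A h' 0 (N - 1) (by omega)).2
  rw [zero_add] at hd
  have hle : ⌊D f 0⌋ ≤ ⌊D f (N-1)⌋ :=
    Int.floor_mono (mono_of _ N l A hl h' 0 (N-1) (by omega) (by omega))
  have hcast : (((⌊D f (N-1)⌋ + 1 - ⌊D f 0⌋).toNat : ℕ) : ℝ) = ⌊D f (N-1)⌋ + 1 - ⌊D f 0⌋ := by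
    have : (((⌊D f (N-1)⌋ + 1 - ⌊D f 0⌋).toNat : ℕ) : ℤ) = ⌊D f (N-1)⌋ + 1 - ⌊D f 0⌋ :=
      Int.toNat_of_nonneg (by omega)
    exact_mod_cast this
  have c1 := Int.floor_le (D f (N-1))
  have c2 := Int.lt_floor_add_one (D f 0)
  have c3 : ((N - 1 : ℕ) : ℝ) * (A * l) ≤ N * (|A| * l) := by
    have : ((N - 1 : ℕ) : ℝ) ≤ N := by exact_mod_cast Nat.sub_le _ _
    have : A * l ≤ |A| * l := mul_le_mul_of_nonneg_right (le_abs_self A) hl.le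
    have : 0 ≤ |A| * l := by positivity
    have : 0 ≤ ((N - 1 : ℕ) : ℝ) := by positivity
    nlinarith
  rw [hcast]
  set d := √l with hd
  have hd0 : 0 < d := Real.sqrt_pos.mpr hl
  have hdd : d * d = l := Real.mul_self_sqrt hl.le
  have c4 : (⌊D f (N-1)⌋ : ℝ) + 1 - ⌊D f 0⌋ ≤ N * (|A| * l) + 2 := by linarith
  calc _ ≤ (N * (|A| * l) + 2) * (6 / d) := by gcongr
    _ = 6 * |A| * (N * d) + 12 * d⁻¹ := by rw [← hdd]; field_simp; ring
    _ ≤ _ := by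
      have : 0 ≤ d⁻¹ := by positivity
      nlinarith [mul_nonneg hA this]

end VdC

namespace VdC

/-- shifted copies of the sequence -/
noncomputable def vv (z : ℕ → ℂ) (N h p : ℕ) : ℂ := if h ≤ p ∧ p < N + h then z (p - h) else 0

lemma vv_sum (z : ℕ → ℂ) (N H h : ℕ) (hh : h < H) :
    ∑ p ∈ Finset.range (N + H), vv z N h p = ∑ n ∈ Finset.range N, z n := by
  unfold vv
  rw [← Finset.sum_filter]
  have : (Finset.range (N + H)).filter (fun p => h ≤ p ∧ p < N + h) = Finset.Ico h (N + h) := by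
    ext x; simp only [Finset.mem_filter, Finset.mem_range, Finset.mem_Ico]; omega
  rw [this, Finset.sum_Ico_eq_sum_range]
  simp

lemma vv_corr (z : ℕ → ℂ) (N H h d : ℕ) (hh : h + d < H) :
    ∑ p ∈ Finset.range (N + H), vv z N h p * (starRingEnd ℂ) (vv z N (h + d) p)
      = ∑ n ∈ Finset.range (N - d), z (n + d) * (starRingEnd ℂ) (z n) := by
  have e : ∀ p, vv z N h p * (starRingEnd ℂ) (vv z N (h + d) p)
      = if h + d ≤ p ∧ p < N + h then z (p - h) * (starRingEnd ℂ) (z (p - (h + d))) else 0 := by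
    intro p
    unfold vv
    by_cases h1 : h + d ≤ p ∧ p < N + h
    · rw [if_pos (by omega), if_pos (by omega), if_pos h1]
    · rw [if_neg h1]
      by_cases h2 : h ≤ p ∧ p < N + h
      · rw [if_neg (show ¬ (h + d ≤ p ∧ p < N + (h + d)) by omega)]; simp
      · rw [if_neg h2]; simp
  rw [Finset.sum_congr rfl (fun p _ => e p), ← Finset.sum_filter]
  have : (Finset.range (N + H)).filter (fun p => h + d ≤ p ∧ p < N + h)
      = Finset.Ico (h + d) (N + h) := by
    ext x; simp only [Finset.mem_filter, Finset.mem_range, Finset.mem_Ico]; omega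
  rw [this, Finset.sum_Ico_eq_sum_range]
  have : N + h - (h + d) = N - d := by omega
  rw [this]
  refine Finset.sum_congr rfl (fun n _ => ?_)
  congr 2
  · congr 1; omega
  · congr 1; omega

lemma sum_dist (B : ℕ → ℝ) (hB : ∀ d, 0 ≤ B d) (N : ℝ) (H h : ℕ) (hh : h < H) :
    ∑ h' ∈ Finset.range H, (if h = h' then N else B (h - h' + (h' - h)))
      ≤ N + 2 * ∑ d ∈ Finset.Ico 1 H, B d := by
  have e : Finset.range H = (Finset.range h ∪ {h}) ∪ Finset.Ico (h + 1) H := by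
    ext x; simp only [Finset.mem_union, Finset.mem_range, Finset.mem_Ico, Finset.mem_singleton]; omega
  rw [e, Finset.sum_union, Finset.sum_union]
  · have b1 : ∑ h' ∈ Finset.range h, (if h = h' then N else B (h - h' + (h' - h)))
        ≤ ∑ d ∈ Finset.Ico 1 H, B d := by
      have : ∑ h' ∈ Finset.range h, (if h = h' then N else B (h - h' + (h' - h)))
          = ∑ d ∈ (Finset.range h).image (fun h' => h - h'), B d := by
        rw [Finset.sum_image]
        · refine Finset.sum_congr rfl (fun x hx => ?_)
          rw [Finset.mem_range] at hx
          rw [if_neg (by omega)]; congr 1; omega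
        · intro x hx y hy hxy
          simp only [Finset.coe_range, Set.mem_Iio] at hx hy hxy
          omega
      rw [this]
      refine Finset.sum_le_sum_of_subset_of_nonneg ?_ (fun i _ _ => hB i)
      intro x hx
      simp only [Finset.mem_image, Finset.mem_range] at hx
      obtain ⟨y, hy, rfl⟩ := hx
      rw [Finset.mem_Ico]; omega
    have b2 : ∑ h' ∈ Finset.Ico (h + 1) H, (if h = h' then N else B (h - h' + (h' - h)))
        ≤ ∑ d ∈ Finset.Ico 1 H, B d := by
      have : ∑ h' ∈ Finset.Ico (h + 1) H, (if h = h' then N else B (h - h' + (h' - h)))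
          = ∑ d ∈ (Finset.Ico (h + 1) H).image (fun h' => h' - h), B d := by
        rw [Finset.sum_image]
        · refine Finset.sum_congr rfl (fun x hx => ?_)
          rw [Finset.mem_Ico] at hx
          rw [if_neg (by omega)]; congr 1; omega
        · intro x hx y hy hxy
          simp only [Finset.coe_Ico, Set.mem_Ico] at hx hy hxy
          omega
      rw [this]
      refine Finset.sum_le_sum_of_subset_of_nonneg ?_ (fun i _ _ => hB i)
      intro x hx
      simp only [Finset.mem_image, Finset.mem_Ico] at hx
      obtain ⟨y, hy, rfl⟩ := hx
      rw [Finset.mem_Ico]; omega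
    rw [Finset.sum_singleton, if_pos rfl]
    linarith
  · rw [Finset.disjoint_left]; intro x hx; simp only [Finset.mem_range, Finset.mem_singleton] at *; omega
  · rw [Finset.disjoint_left]; intro x hx
    simp only [Finset.mem_union, Finset.mem_range, Finset.mem_Ico, Finset.mem_singleton] at *; omega

lemma vdc_ineq (z : ℕ → ℂ) (hz : ∀ n, ‖z n‖ = 1) (N H : ℕ) (hH : 1 ≤ H) (B : ℕ → ℝ)
    (hB : ∀ d, 0 ≤ B d)
    (h : ∀ d, 1 ≤ d → d < H →
      ‖∑ n ∈ Finset.range (N - d), z (n + d) * (starRingEnd ℂ) (z n)‖ ≤ B d) :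
    H * ‖∑ n ∈ Finset.range N, z n‖ ^ 2 ≤ (N + H) * (N + 2 * ∑ d ∈ Finset.Ico 1 H, B d) := by
  set S := ∑ n ∈ Finset.range N, z n with hS
  set v := vv z N
  have e1 : (H : ℂ) * S = ∑ p ∈ Finset.range (N + H), ∑ i ∈ Finset.range H, v i p := by
    rw [Finset.sum_comm, Finset.sum_congr rfl (fun i hi => vv_sum z N H i (Finset.mem_range.mp hi))]
    simp [hS]
  have e2 : (H * ‖S‖) ^ 2 ≤ (N + H) * ∑ p ∈ Finset.range (N + H), ‖∑ i ∈ Finset.range H, v i p‖ ^ 2 := by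
    have : H * ‖S‖ ≤ ∑ p ∈ Finset.range (N + H), ‖∑ i ∈ Finset.range H, v i p‖ := by
      have : H * ‖S‖ = ‖(H : ℂ) * S‖ := by rw [norm_mul]; simp
      rw [this, e1]
      exact _root_.norm_sum_le _ _
    have h2 := sq_sum_le_card_mul_sum_sq (s := Finset.range (N + H))
      (f := fun p => ‖∑ i ∈ Finset.range H, v i p‖)
    rw [Finset.card_range] at h2
    push_cast at h2
    refine le_trans ?_ h2
    gcongr
  have corr : ∀ i ∈ Finset.range H, ∀ j ∈ Finset.range H,
      ‖∑ p ∈ Finset.range (N + H), v i p * (starRingEnd ℂ) (v j p)‖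
        ≤ if i = j then (N : ℝ) else B (i - j + (j - i)) := by
    intro i hi j hj
    rw [Finset.mem_range] at hi hj
    rcases lt_trichotomy i j with hij | hij | hij
    · rw [if_neg (by omega)]
      obtain ⟨d, rfl⟩ := Nat.exists_eq_add_of_le hij.le
      rw [vv_corr z N H i d hj]
      have : i - (i + d) + (i + d - i) = d := by omega
      rw [this]
      exact h d (by omega) (by omega)
    · subst hij
      rw [if_pos rfl]
      have := vv_corr z N H i 0 hi
      rw [add_zero] at this
      rw [this]
      refine (_root_.norm_sum_le _ _).trans ?_
      simp [hz]
    · rw [if_neg (by omega)]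
      obtain ⟨d, rfl⟩ := Nat.exists_eq_add_of_le hij.le
      have e : ∑ p ∈ Finset.range (N + H), v (j + d) p * (starRingEnd ℂ) (v j p)
          = (starRingEnd ℂ) (∑ p ∈ Finset.range (N + H), v j p * (starRingEnd ℂ) (v (j + d) p)) := by
        rw [map_sum]
        refine Finset.sum_congr rfl (fun p _ => ?_)
        rw [map_mul, Complex.conj_conj, mul_comm]
      rw [e, RCLike.norm_conj, vv_corr z N H j d hi]
      have : j + d - j + (j - (j + d)) = d := by omega
      rw [this]
      exact h d (by omega) (by omega)
  have e3 : ∑ p ∈ Finset.range (N + H), ‖∑ i ∈ Finset.range H, v i p‖ ^ 2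
      ≤ H * (N + 2 * ∑ d ∈ Finset.Ico 1 H, B d) := by
    have e4 : ((∑ p ∈ Finset.range (N + H), ‖∑ i ∈ Finset.range H, v i p‖ ^ 2 : ℝ) : ℂ)
        = ∑ i ∈ Finset.range H, ∑ j ∈ Finset.range H, ∑ p ∈ Finset.range (N + H),
            v i p * (starRingEnd ℂ) (v j p) := by
      have : ∀ i ∈ Finset.range H, ∑ j ∈ Finset.range H, ∑ p ∈ Finset.range (N + H),
            v i p * (starRingEnd ℂ) (v j p) = ∑ p ∈ Finset.range (N + H), ∑ j ∈ Finset.range H,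
            v i p * (starRingEnd ℂ) (v j p) := fun i _ => Finset.sum_comm
      rw [Finset.sum_congr rfl this, Finset.sum_comm]
      push_cast
      refine Finset.sum_congr rfl (fun p _ => ?_)
      rw [← Complex.mul_conj', map_sum, Finset.sum_mul_sum]
    have e5 : ∑ p ∈ Finset.range (N + H), ‖∑ i ∈ Finset.range H, v i p‖ ^ 2
        = ‖((∑ p ∈ Finset.range (N + H), ‖∑ i ∈ Finset.range H, v i p‖ ^ 2 : ℝ) : ℂ)‖ := by
      rw [Complex.norm_real, Real.norm_of_nonneg]
      exact Finset.sum_nonneg (fun _ _ => by positivity)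
    rw [e5, e4]
    refine (_root_.norm_sum_le _ _).trans ?_
    have : (H : ℝ) * (N + 2 * ∑ d ∈ Finset.Ico 1 H, B d)
        = ∑ i ∈ Finset.range H, ((N : ℝ) + 2 * ∑ d ∈ Finset.Ico 1 H, B d) := by
      rw [Finset.sum_const, Finset.card_range, nsmul_eq_mul]
    rw [this]
    refine Finset.sum_le_sum (fun i hi => ?_)
    refine (_root_.norm_sum_le _ _).trans ?_
    refine (Finset.sum_le_sum (fun j hj => corr i hi j hj)).trans ?_
    exact sum_dist B hB N H i (Finset.mem_range.mp hi)
  have hHp : (0:ℝ) < H := by exact_mod_cast hH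
  have e6 : (H * ‖S‖) ^ 2 ≤ (N + H) * (H * (N + 2 * ∑ d ∈ Finset.Ico 1 H, B d)) :=
    e2.trans (by gcongr)
  refine le_of_mul_le_mul_left ?_ hHp
  nlinarith

lemma D_shift (k : ℕ) (f : ℕ → ℝ) (d n : ℕ) :
    D^[k] (fun n => f (n + d) - f n) n = D^[k] f (n + d) - D^[k] f n := by
  induction k generalizing n with
  | zero => rfl
  | succ k ih =>
    rw [Function.iterate_succ_apply', Function.iterate_succ_apply']
    unfold D at *
    rw [ih, ih, add_right_comm]
    ring

lemma sum_inv_sqrt' (H : ℕ) : ∑ d ∈ Finset.Ico 1 (H + 1), ((d : ℝ) ^ (-(1/2) : ℝ)) ≤ 2 * √H := by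
  induction H with
  | zero => simp
  | succ H ih =>
    rw [Finset.sum_Ico_succ_top (by omega)]
    have hp : (0:ℝ) ≤ H := by positivity
    have hp1 : (0:ℝ) < H + 1 := by positivity
    push_cast
    rw [Real.rpow_neg hp1.le, ← Real.sqrt_eq_rpow]
    have a0 := Real.sqrt_pos.mpr hp1
    have a1 := Real.mul_self_sqrt hp
    have a2 := Real.mul_self_sqrt hp1.le
    set a := √(H : ℝ)
    set b := √((H : ℝ) + 1)
    have : b⁻¹ ≤ 2 * b - 2 * a := by
      rw [inv_le_iff_one_le_mul₀ a0]
      nlinarith [sq_nonneg (b - a)]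
    linarith

lemma sum_inv_sqrt (H : ℕ) : ∑ d ∈ Finset.Ico 1 H, ((d : ℝ) ^ (-(1/2) : ℝ)) ≤ 2 * √H := by
  refine le_trans ?_ (sum_inv_sqrt' H)
  apply Finset.sum_le_sum_of_subset_of_nonneg
  · exact Finset.Ico_subset_Ico_right (by omega)
  · intros; positivity

lemma sum_inv_rpow (H : ℕ) (hH : 1 ≤ H) (κ : ℝ) (h1 : κ ≤ 1/2) :
    ∑ d ∈ Finset.Ico 1 H, ((d : ℝ) ^ (-κ)) ≤ 2 * H * (H : ℝ) ^ (-κ) := by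
  have hp : (0:ℝ) < H := by exact_mod_cast hH
  have : ∀ d ∈ Finset.Ico 1 H, (d : ℝ) ^ (-κ) ≤ (H : ℝ) ^ (1/2 - κ) * (d : ℝ) ^ (-(1/2) : ℝ) := by
    intro d hd
    rw [Finset.mem_Ico] at hd
    have hd0 : (0:ℝ) < d := by exact_mod_cast hd.1
    have e : (d : ℝ) ^ (-κ) = (d : ℝ) ^ (1/2 - κ) * (d : ℝ) ^ (-(1/2) : ℝ) := by
      rw [← Real.rpow_add hd0]; congr 1; ring
    rw [e]
    gcongr
    exact_mod_cast hd.2.le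
  refine (Finset.sum_le_sum this).trans ?_
  rw [← Finset.mul_sum]
  have h2 := sum_inv_sqrt H
  calc _ ≤ (H : ℝ) ^ (1/2 - κ) * (2 * √H) := by gcongr
    _ = 2 * ((H : ℝ) ^ (1/2 - κ) * (H : ℝ) ^ (1/2 : ℝ)) := by rw [Real.sqrt_eq_rpow]; ring
    _ = 2 * ((H : ℝ) ^ (1 : ℝ) * (H : ℝ) ^ (-κ)) := by
      rw [← Real.rpow_add hp, ← Real.rpow_add hp]; congr 2; ring
    _ = _ := by rw [Real.rpow_one]; ring

lemma step (k : ℕ) (κ σ : ℝ) (hκ : 0 < κ) (hκ1 : κ ≤ 1/2) (hσ : 0 ≤ σ) (hσ1 : σ ≤ 1)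
    (hP : P k κ σ) : P (k + 1) (κ / (1 + κ) / 2) (σ / 2) := by
  intro A
  obtain ⟨C, hC, hP⟩ := hP A
  set ρ := κ / (1 + κ) with hρ
  have hρ0 : 0 < ρ := by positivity
  refine ⟨√(2 + 8 * C), by positivity, ?_⟩
  intro f N l hl h
  have hK1 : 1 ≤ √(2 + 8 * C) := by rw [Real.one_le_sqrt]; linarith
  have q1 : 0 ≤ (N : ℝ) * l ^ (ρ / 2) := by positivity
  have q2 : 0 ≤ (N : ℝ) ^ (1 - σ / 2) * l ^ (-(ρ / 2)) := by positivity
  rcases le_total 1 l with hl1 | hl1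
  · have := triv f N l (ρ / 2) (by positivity) hl1
    nlinarith
  rcases Nat.eq_zero_or_pos N with rfl | hN
  · simp only [Finset.range_zero, Finset.sum_empty, norm_zero]; positivity
  have hN0 : (0:ℝ) < N := by exact_mod_cast hN
  have hN1 : (1:ℝ) ≤ N := by exact_mod_cast hN
  -- suffices the squared bound
  suffices hsq : ‖∑ n ∈ Finset.range N, ee (f n)‖ ^ 2
      ≤ (2 + 8 * C) * ((N : ℝ) ^ 2 * l ^ ρ + N * (N : ℝ) ^ (1 - σ) * l ^ (-ρ)) by
    have s1 : ((N : ℝ) * l ^ (ρ / 2)) ^ 2 = (N : ℝ) ^ 2 * l ^ ρ := by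
      rw [mul_pow, ← Real.rpow_natCast (l ^ (ρ / 2)), ← Real.rpow_mul hl.le]
      congr 2; push_cast; ring
    have s2 : ((N : ℝ) ^ (1 - σ / 2) * l ^ (-(ρ / 2))) ^ 2 = N * (N : ℝ) ^ (1 - σ) * l ^ (-ρ) := by
      rw [mul_pow, ← Real.rpow_natCast (l ^ (-(ρ / 2))), ← Real.rpow_mul hl.le,
        ← Real.rpow_natCast ((N : ℝ) ^ (1 - σ / 2)), ← Real.rpow_mul hN0.le,
        ← Real.rpow_one_add' hN0.le (by linarith)]
      congr 2 <;> (push_cast; ring)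
    refine le_of_sq_le_sq ?_ (by positivity)
    rw [mul_pow, Real.sq_sqrt (by positivity)]
    refine hsq.trans ?_
    rw [← s1, ← s2]
    have : 0 ≤ 2 + 8 * C := by positivity
    gcongr
    nlinarith [mul_nonneg q1 q2]
  set X := l ^ (-ρ) with hX
  have hX1 : 1 ≤ X := Real.one_le_rpow_of_pos_of_le_one_of_nonpos hl hl1 (by linarith)
  set H := ⌈X⌉₊ with hH
  have hHX : X ≤ H := Nat.le_ceil X
  have hH2 : (H : ℝ) ≤ 2 * X := by
    have := Nat.ceil_lt_add_one (show 0 ≤ X by linarith)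
    linarith
  have hH1 : 1 ≤ H := by exact_mod_cast hX1.trans hHX
  have hH0 : (0:ℝ) < H := by exact_mod_cast hH1
  have hNs : 1 ≤ (N : ℝ) ^ (1 - σ) := Real.one_le_rpow hN1 (by linarith)
  have hlr : 0 ≤ l ^ ρ := by positivity
  rcases lt_or_ge N H with hNH | hNH
  · have t := norm_sum_le f (Finset.range N)
    rw [Finset.card_range] at t
    have t2 : (N : ℝ) ≤ 2 * X := le_trans (by exact_mod_cast hNH.le) hH2
    have t3 : ‖∑ n ∈ Finset.range N, ee (f n)‖ ^ 2 ≤ (N : ℝ) ^ 2 := by gcongr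
    have t4 : (N : ℝ) * X ≤ N * (N : ℝ) ^ (1 - σ) * X := by
      have : 0 ≤ (N : ℝ) * X := by positivity
      nlinarith
    have t5 : 0 ≤ (N : ℝ) ^ 2 * l ^ ρ := by positivity
    have t6 : 0 ≤ C * ((N : ℝ) ^ 2 * l ^ ρ + N * (N : ℝ) ^ (1 - σ) * X) := by positivity
    nlinarith
  -- main case
  set B : ℕ → ℝ := fun d => C * (N * (d * l) ^ κ + (N : ℝ) ^ (1 - σ) * (d * l) ^ (-κ)) with hB
  have main := vdc_ineq (fun n => ee (f n)) (fun n => norm_ee _) N H hH1 B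
    (fun d => by simp only [hB]; positivity) (by
      intro d hd hdH
      have hd0 : (0:ℝ) < d := by exact_mod_cast hd
      have e : ∀ n ∈ Finset.range (N - d), ee (f (n + d)) * (starRingEnd ℂ) (ee (f n))
          = ee ((fun n => f (n + d) - f n) n) := fun n _ => (ee_sub _ _).symm
      rw [Finset.sum_congr rfl e]
      refine (hP (fun n => f (n + d) - f n) (N - d) (d * l) (by positivity) ?_).trans ?_
      · intro n hn
        rw [D_shift]
        have := diff_bounds (D^[k] f) N l A (by
          intro n hn
          have := h n hn
          rwa [Function.iterate_succ_apply'] at this) n d (by omega)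
        refine ⟨this.1, this.2.trans (le_of_eq (by ring))⟩
      · simp only [hB]
        have : ((N - d : ℕ) : ℝ) ≤ N := by exact_mod_cast Nat.sub_le _ _
        gcongr)
  have sB : ∑ d ∈ Finset.Ico 1 H, B d
      ≤ C * (N * (H * (H * l) ^ κ) + (N : ℝ) ^ (1 - σ) * (2 * H * (H * l) ^ (-κ))) := by
    simp only [hB]
    rw [← Finset.mul_sum, Finset.sum_add_distrib, ← Finset.mul_sum, ← Finset.mul_sum]
    gcongr
    · have : ∀ d ∈ Finset.Ico 1 H, ((d : ℝ) * l) ^ κ ≤ (H * l) ^ κ := by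
        intro d hd
        have : (d : ℝ) ≤ H := by exact_mod_cast (Finset.mem_Ico.mp hd).2.le
        gcongr
      refine (Finset.sum_le_sum this).trans ?_
      rw [Finset.sum_const, nsmul_eq_mul, Nat.card_Ico]
      have : ((H - 1 : ℕ) : ℝ) ≤ H := by exact_mod_cast Nat.sub_le _ _
      gcongr
    · have e : ∀ d ∈ Finset.Ico 1 H, ((d : ℝ) * l) ^ (-κ) = (d : ℝ) ^ (-κ) * l ^ (-κ) := by
        intro d _
        rw [Real.mul_rpow (by positivity) hl.le]
      rw [Finset.sum_congr rfl e, ← Finset.sum_mul, Real.mul_rpow hH0.le hl.le, ← mul_assoc]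
      gcongr
      exact sum_inv_rpow H hH1 κ hκ1
  have hXl : X * l = l ^ (1 - ρ) := by
    rw [hX, ← Real.rpow_add_one hl.ne']; congr 1; ring
  have hρκ : (1 - ρ) * κ = ρ := by rw [hρ]; field_simp; ring
  have r1 : ((H : ℝ) * l) ^ κ ≤ 2 * l ^ ρ := by
    calc ((H : ℝ) * l) ^ κ ≤ (2 * (X * l)) ^ κ := by
          apply Real.rpow_le_rpow (by positivity) _ hκ.le
          nlinarith
      _ = 2 ^ κ * l ^ ρ := by
          rw [Real.mul_rpow (by norm_num) (by positivity), hXl, ← Real.rpow_mul hl.le, hρκ]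
      _ ≤ 2 ^ (1:ℝ) * l ^ ρ := by
          gcongr
          · norm_num
          · linarith
      _ = _ := by rw [Real.rpow_one]
  have r2 : ((H : ℝ) * l) ^ (-κ) ≤ X := by
    calc ((H : ℝ) * l) ^ (-κ) ≤ (X * l) ^ (-κ) := by
          apply Real.rpow_le_rpow_of_nonpos (by positivity) _ (by linarith)
          gcongr
      _ = X := by
          rw [hXl, ← Real.rpow_mul hl.le, hX]; congr 1; linarith
  have r3 : 1 ≤ H * l ^ ρ := by
    have : X * l ^ ρ = 1 := by rw [hX, ← Real.rpow_add hl]; simp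
    have : X * l ^ ρ ≤ H * l ^ ρ := by gcongr
    linarith
  have hNHr : (H : ℝ) ≤ N := by exact_mod_cast hNH
  refine le_of_mul_le_mul_left (main.trans ?_) hH0
  set M := (N : ℝ) ^ (1 - σ)
  calc ((N : ℝ) + H) * (N + 2 * ∑ d ∈ Finset.Ico 1 H, B d)
      ≤ (N + N) * (N * (H * l ^ ρ) + 2 * (C * (N * (H * (2 * l ^ ρ)) + M * (2 * H * X)))) := by
        gcongr
        · nlinarith
        · refine sB.trans ?_
          gcongr
    _ ≤ H * ((2 + 8 * C) * (N ^ 2 * l ^ ρ + N * M * X)) := by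
        have : 0 ≤ H * (N * M * X) := by positivity
        nlinarith

lemma Pall (m : ℕ) : P (m + 2) (1 / (2 ^ (m + 2) - 2)) (1 / 2 ^ m) := by
  induction m with
  | zero => convert P2 using 1 <;> norm_num
  | succ m ih =>
    have hm : (1:ℝ) ≤ 2 ^ m := one_le_pow₀ (by norm_num)
    have e : (2:ℝ) ^ (m + 2) = 4 * 2 ^ m := by ring
    have := step (m + 2) _ _ (by rw [e]; apply one_div_pos.mpr; linarith)
      (by rw [e]; apply one_div_le_one_div_of_le <;> linarith) (by positivity)
      (by rw [div_le_one (by positivity)]; exact hm) ih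
    convert this using 1
    · rw [show (2:ℝ) ^ (m + 1 + 2) = 8 * 2 ^ m by ring, e]
      have : (4:ℝ) * 2 ^ m - 2 ≠ 0 := by linarith
      have : (8:ℝ) * 2 ^ m - 2 ≠ 0 := by linarith
      have h4 : (2:ℝ) * 2 ^ m - 1 ≠ 0 := by linarith
      have h5 : (4:ℝ) * 2 ^ m - 1 ≠ 0 := by linarith
      have h3 : (4:ℝ) * 2 ^ m - 1 ≠ 0 := by linarith
      have : 1 + 1 / ((4:ℝ) * 2 ^ m - 2) = (4 * 2 ^ m - 1) / (4 * 2 ^ m - 2) := by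
        field_simp; ring
      rw [this, show (8:ℝ) * 2 ^ m - 2 = 2 * (4 * 2 ^ m - 1) by ring]
      field_simp
    · field_simp; ring

end VdC

namespace VdC

/-- forward difference on the reals -/
def DR (g : ℝ → ℝ) : ℝ → ℝ := fun x => g (x + 1) - g x

lemma DR_deriv (g g' : ℝ → ℝ) (h : ∀ x, 0 < x → HasDerivAt g (g' x) x) (k : ℕ) (x : ℝ)
    (hx : 0 < x) : HasDerivAt (DR^[k] g) (DR^[k] g' x) x := by
  induction k generalizing x with
  | zero => exact h x hx
  | succ k ih =>
    rw [Function.iterate_succ_apply', Function.iterate_succ_apply']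
    unfold DR at *
    exact ((ih (x + 1) (by linarith)).comp_add_const x 1).sub (ih x hx)

lemma DR_smul (a : ℝ) (g : ℝ → ℝ) (k : ℕ) (x : ℝ) :
    DR^[k] (fun y => a * g y) x = a * DR^[k] g x := by
  induction k generalizing x with
  | zero => rfl
  | succ k ih =>
    rw [Function.iterate_succ_apply', Function.iterate_succ_apply']
    unfold DR at *
    rw [ih, ih]; ring

lemma DR_nat (g : ℝ → ℝ) (a k n : ℕ) :
    D^[k] (fun n => g ((a + n : ℕ) : ℝ)) n = DR^[k] g ((a + n : ℕ) : ℝ) := by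
  induction k generalizing n with
  | zero => rfl
  | succ k ih =>
    rw [Function.iterate_succ_apply', Function.iterate_succ_apply']
    unfold DR D at *
    rw [ih, ih]; push_cast; rw [add_assoc]

lemma DR_rpow (k : ℕ) (s x : ℝ) (hx : 0 < x) : ∃ ξ, x ≤ ξ ∧ ξ ≤ x + k ∧
    DR^[k] (fun y => y ^ s) x = (∏ j ∈ Finset.range k, (s - j)) * ξ ^ (s - k) := by
  induction k generalizing s x with
  | zero => exact ⟨x, le_rfl, by simp, by simp⟩
  | succ k ih =>
    have hder : ∀ y, 0 < y → HasDerivAt (DR^[k] (fun y : ℝ => y ^ s))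
        (DR^[k] (fun y : ℝ => s * y ^ (s - 1)) y) y := by
      intro y hy
      exact DR_deriv _ _ (fun y hy => Real.hasDerivAt_rpow_const (Or.inl hy.ne')) k y hy
    obtain ⟨y, hy, he⟩ := exists_hasDerivAt_eq_slope (DR^[k] (fun y : ℝ => y ^ s))
      (DR^[k] (fun y : ℝ => s * y ^ (s - 1))) (show x < x + 1 by linarith)
      (fun y hy => (hder y (by linarith [hy.1])).continuousAt.continuousWithinAt)
      (fun y hy => hder y (by linarith [hy.1]))
    obtain ⟨ξ, h1, h2, h3⟩ := ih (s - 1) y (by linarith [hy.1])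
    refine ⟨ξ, by linarith [hy.1], by push_cast; linarith [hy.2], ?_⟩
    rw [Function.iterate_succ_apply']
    rw [DR_smul, h3] at he
    have e : x + 1 - x = 1 := by ring
    rw [e, div_one] at he
    unfold DR at he ⊢
    rw [← he, Finset.prod_range_succ']
    have e2 : ∀ j ∈ Finset.range k, s - 1 - (j : ℝ) = s - ((j + 1 : ℕ) : ℝ) := by
      intro j _; push_cast; ring
    rw [Finset.prod_congr rfl e2]
    have e3 : s - 1 - (k : ℝ) = s - ((k + 1 : ℕ) : ℝ) := by push_cast; ring
    rw [e3]
    push_cast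
    ring

lemma two_rpow_lower (θ : ℝ) (h0 : 0 ≤ θ) : 1 + 0.69 * θ ≤ (2:ℝ) ^ θ := by
  rw [Real.rpow_def_of_pos (by norm_num)]
  have := Real.add_one_le_exp (Real.log 2 * θ)
  have := Real.log_two_gt_d9
  nlinarith

lemma exps (θ t : ℝ) (h0 : 0 < θ) (h1 : θ < 1) (ht : 2 ≤ t) :
    min θ (1 - θ) / (t * 2 ^ θ) ≤ (2 - θ) * (1 / (4 * t - 2)) ∧
    min θ (1 - θ) / (t * 2 ^ θ) ≤ 1 / t - (2 - θ) * (1 / (4 * t - 2)) := by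
  have hl := two_rpow_lower θ h0.le
  have ht0 : 0 < t := by linarith
  have hp : 0 < (2:ℝ) ^ θ := by positivity
  set μ := min θ (1 - θ) / 2 ^ θ with hμ
  have e : min θ (1 - θ) / (t * 2 ^ θ) = μ * (1 / t) := by rw [hμ]; field_simp
  have m1 : min θ (1 - θ) ≤ θ := min_le_left _ _
  have m2 : min θ (1 - θ) ≤ 1 - θ := min_le_right _ _
  have b1 : μ ≤ (2 - θ) / 4 := by
    rw [hμ, div_le_iff₀ hp]
    have : (2 - θ) / 4 * (1 + 0.69 * θ) ≤ (2 - θ) / 4 * 2 ^ θ := by gcongr; linarith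
    refine le_trans ?_ this
    rcases le_total θ (1/2) with h | h
    · nlinarith
    · nlinarith
  have b2 : μ ≤ (1 + θ) / 3 := by
    rw [hμ, div_le_iff₀ hp]
    have : (1 + θ) / 3 * (1 + 0.69 * θ) ≤ (1 + θ) / 3 * 2 ^ θ := by gcongr
    refine le_trans ?_ this
    rcases le_total θ (1/2) with h | h
    · nlinarith [sq_nonneg (θ - 1)]
    · nlinarith
  have hd : 0 < 4 * t - 2 := by linarith
  have ht' : 0 < 1 / t := by positivity
  rw [e]
  constructor
  · calc μ * (1 / t) ≤ (2 - θ) / 4 * (1 / t) := by gcongr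
      _ = (2 - θ) * (1 / (4 * t)) := by field_simp
      _ ≤ _ := by
        apply mul_le_mul_of_nonneg_left _ (by linarith)
        apply one_div_le_one_div_of_le <;> linarith
  · have h3 : (2 - θ) * (1 / (4 * t - 2)) ≤ (2 - θ) * (1 / (3 * t)) := by
      apply mul_le_mul_of_nonneg_left _ (by linarith)
      apply one_div_le_one_div_of_le <;> linarith
    have h4 : (2 - θ) * (1 / (3 * t)) = (2 - θ) / 3 * (1 / t) := by field_simp
    have h5 : μ * (1 / t) ≤ (1 + θ) / 3 * (1 / t) := by gcongr
    have h6 : (1 + θ) / 3 * (1 / t) = 1 / t - (2 - θ) / 3 * (1 / t) := by ring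
    linarith

/-- one dyadic block -/
lemma block (c : ℝ) (hcint : ∀ n : ℤ, c ≠ (n : ℝ)) (η : ℝ) (hη : 0 < η) (k : ℕ) (κ σ α : ℝ)
    (hκ : 0 < κ) (hκ1 : κ ≤ 1) (hσ1 : σ ≤ 1) (hck : c < k)
    (hP : P k κ σ) (ha : 1 - (k - c) * κ ≤ α) (hb : 1 - σ + (k - c) * κ ≤ α) :
    ∃ C : ℝ, 0 ≤ C ∧ ∀ U : ℝ, η ≤ |U| → ∀ N M L : ℕ, 1 ≤ N → (N : ℝ) / 2 ≤ M → M + L = N + 1 →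
      ‖∑ n ∈ Finset.range L, ee (U * ((M + n : ℕ) : ℝ) ^ c)‖ ≤ C * |U| * (N : ℝ) ^ α := by
  set τ : ℝ := k - c with hτ
  have hτ0 : 0 < τ := by rw [hτ]; linarith
  set Q : ℝ := ∏ j ∈ Finset.range k, (c - j) with hQ
  have hQ0 : Q ≠ 0 := by
    rw [hQ, Finset.prod_ne_zero_iff]
    intro j _ h
    exact hcint j (by push_cast; linarith)
  have hp : 0 < |Q| := abs_pos.mpr hQ0
  obtain ⟨C, hC, hP⟩ := hP ((1/2 : ℝ) ^ (-τ) / ((k : ℝ) + 1) ^ (-τ))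
  set q : ℝ := |Q| * ((k : ℝ) + 1) ^ (-τ) with hq
  have hq0 : 0 < q := by positivity
  refine ⟨C * (q ^ κ * η ^ (κ - 1) + q ^ (-κ) * η ^ (-κ - 1)), by positivity, ?_⟩
  intro U hU N M L hN hM hML
  have hU0 : 0 < |U| := lt_of_lt_of_le hη hU
  have hN0 : (0:ℝ) < N := by exact_mod_cast hN
  have hN1 : (1:ℝ) ≤ N := by exact_mod_cast hN
  obtain ⟨W, hW, hWn⟩ : ∃ W : ℝ, W * Q = |U| * |Q| ∧
      ‖∑ n ∈ Finset.range L, ee (U * ((M + n : ℕ) : ℝ) ^ c)‖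
        = ‖∑ n ∈ Finset.range L, ee (W * ((M + n : ℕ) : ℝ) ^ c)‖ := by
    rw [← abs_mul]
    rcases abs_choice (U * Q) with h | h
    · exact ⟨U, h.symm, rfl⟩
    · refine ⟨-U, by rw [h]; ring, ?_⟩
      have : ∀ n ∈ Finset.range L, ee (-U * ((M + n : ℕ) : ℝ) ^ c)
          = (starRingEnd ℂ) (ee (U * ((M + n : ℕ) : ℝ) ^ c)) := by
        intro n _; rw [← ee_neg]; congr 1; ring
      rw [Finset.sum_congr rfl this, ← map_sum, RCLike.norm_conj]
  rw [hWn]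
  set l : ℝ := |U| * (q * (N : ℝ) ^ (-τ)) with hl
  have hl0 : 0 < l := by positivity
  have hmain := hP (fun n => W * ((M + n : ℕ) : ℝ) ^ c) L l hl0 (by
    intro n hn
    have hM0 : (0:ℝ) < M := by linarith
    have hx : (0:ℝ) < ((M + n : ℕ) : ℝ) := by push_cast; positivity
    have hnN : ((M + n : ℕ) : ℝ) ≤ N := by exact_mod_cast (by omega : M + n ≤ N)
    have hnM : (M : ℝ) ≤ ((M + n : ℕ) : ℝ) := by push_cast; linarith [(Nat.cast_nonneg n : (0:ℝ) ≤ n)]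
    rw [DR_nat (fun y => W * y ^ c) M k n, DR_smul]
    obtain ⟨ξ, h1, h2, h3⟩ := DR_rpow k c ((M + n : ℕ) : ℝ) hx
    rw [h3, ← hQ, ← mul_assoc, hW, show c - (k : ℝ) = -τ by rw [hτ]; ring]
    have hk : (0:ℝ) ≤ k := by positivity
    have hξ : ξ ≤ (k + 1) * N := by nlinarith
    have hξ2 : 1 / 2 * (N : ℝ) ≤ ξ := by linarith
    have hξ0 : 0 < ξ := by linarith
    have u1 : (((k : ℝ) + 1) * N) ^ (-τ) ≤ ξ ^ (-τ) :=
      Real.rpow_le_rpow_of_nonpos hξ0 hξ (by linarith)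
    have u2 : ξ ^ (-τ) ≤ (1 / 2 * (N : ℝ)) ^ (-τ) :=
      Real.rpow_le_rpow_of_nonpos (by positivity) hξ2 (by linarith)
    rw [Real.mul_rpow (by positivity) hN0.le] at u1 u2
    constructor
    · rw [hl, hq]
      calc _ = |U| * |Q| * (((k : ℝ) + 1) ^ (-τ) * (N : ℝ) ^ (-τ)) := by ring
        _ ≤ _ := by gcongr
    · rw [hl, hq]
      have hk1 : ((k : ℝ) + 1) ^ (-τ) ≠ 0 := by positivity
      calc _ ≤ |U| * |Q| * ((1 / 2) ^ (-τ) * (N : ℝ) ^ (-τ)) := by gcongr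
        _ = _ := by field_simp)
  have hLN : (L : ℝ) ≤ N := by
    have : 0 < M := by
      have : (0:ℝ) < M := by linarith
      exact_mod_cast this
    exact_mod_cast (by omega : L ≤ N)
  have hmain2 : C * (L * l ^ κ + (L : ℝ) ^ (1 - σ) * l ^ (-κ))
      ≤ C * (N * l ^ κ + (N : ℝ) ^ (1 - σ) * l ^ (-κ)) := by
    have := Real.rpow_le_rpow (by positivity) hLN (show 0 ≤ 1 - σ by linarith)
    gcongr
  refine hmain.trans (hmain2.trans ?_)
  have v1 : (N : ℝ) * l ^ κ ≤ q ^ κ * η ^ (κ - 1) * |U| * (N : ℝ) ^ α := by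
    rw [hl, Real.mul_rpow hU0.le (by positivity), Real.mul_rpow hq0.le (by positivity),
      ← Real.rpow_mul hN0.le]
    have w1 : |U| ^ κ ≤ η ^ (κ - 1) * |U| := by
      have : |U| ^ κ = |U| ^ (κ - 1) * |U| := by
        rw [← Real.rpow_add_one hU0.ne']; congr 1; ring
      rw [this]
      exact mul_le_mul_of_nonneg_right (Real.rpow_le_rpow_of_nonpos hη hU (by linarith)) hU0.le
    have w2 : (N : ℝ) * (N : ℝ) ^ (-τ * κ) ≤ (N : ℝ) ^ α := by
      rw [mul_comm, ← Real.rpow_add_one hN0.ne']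
      exact Real.rpow_le_rpow_of_exponent_le hN1 (by linarith)
    calc _ = |U| ^ κ * q ^ κ * ((N : ℝ) * (N : ℝ) ^ (-τ * κ)) := by ring
      _ ≤ (η ^ (κ - 1) * |U|) * q ^ κ * (N : ℝ) ^ α := by gcongr
      _ = _ := by ring
  have v2 : (N : ℝ) ^ (1 - σ) * l ^ (-κ) ≤ q ^ (-κ) * η ^ (-κ - 1) * |U| * (N : ℝ) ^ α := by
    rw [hl, Real.mul_rpow hU0.le (by positivity), Real.mul_rpow hq0.le (by positivity),
      ← Real.rpow_mul hN0.le]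
    have w1 : |U| ^ (-κ) ≤ η ^ (-κ - 1) * |U| := by
      have : |U| ^ (-κ) = |U| ^ (-κ - 1) * |U| := by
        rw [← Real.rpow_add_one hU0.ne']; congr 1; ring
      rw [this]
      exact mul_le_mul_of_nonneg_right (Real.rpow_le_rpow_of_nonpos hη hU (by linarith)) hU0.le
    have w2 : (N : ℝ) ^ (1 - σ) * (N : ℝ) ^ (-τ * -κ) ≤ (N : ℝ) ^ α := by
      rw [← Real.rpow_add hN0]
      exact Real.rpow_le_rpow_of_exponent_le hN1 (by linarith)
    calc _ = |U| ^ (-κ) * q ^ (-κ) * ((N : ℝ) ^ (1 - σ) * (N : ℝ) ^ (-τ * -κ)) := by ring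
      _ ≤ (η ^ (-κ - 1) * |U|) * q ^ (-κ) * (N : ℝ) ^ α := by gcongr
      _ = _ := by ring
  calc _ ≤ C * (q ^ κ * η ^ (κ - 1) * |U| * (N : ℝ) ^ α
        + q ^ (-κ) * η ^ (-κ - 1) * |U| * (N : ℝ) ^ α) :=
        mul_le_mul_of_nonneg_left (add_le_add v1 v2) hC
    _ = _ := by ring

lemma dyadic (c α C U : ℝ) (hα : 0 < α) (hC : 0 ≤ C)
    (h : ∀ N M L : ℕ, 1 ≤ N → (N : ℝ) / 2 ≤ M → M + L = N + 1 →
      ‖∑ n ∈ Finset.range L, ee (U * ((M + n : ℕ) : ℝ) ^ c)‖ ≤ C * |U| * (N : ℝ) ^ α) (N : ℕ) :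
    ‖∑ n ∈ Finset.Icc 1 N, ee (U * (n : ℝ) ^ c)‖
      ≤ (C / (1 - (1/2) ^ α) + 1) * |U| * (N : ℝ) ^ α := by
  have hh : (1/2 : ℝ) ^ α < 1 := Real.rpow_lt_one (by norm_num) (by norm_num) hα
  set K := C / (1 - (1/2 : ℝ) ^ α) + 1 with hK
  have hK0 : 0 < K := by
    have : 0 < 1 - (1/2 : ℝ) ^ α := by linarith
    positivity
  have hKC : C ≤ K * (1 - (1/2 : ℝ) ^ α) := by
    have : 0 < 1 - (1/2 : ℝ) ^ α := by linarith
    rw [hK, add_mul, div_mul_cancel₀ _ this.ne']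
    linarith
  induction N using Nat.strong_induction_on with
  | _ N ih =>
  rcases Nat.eq_zero_or_pos N with rfl | hN
  · simp; positivity
  have h1 := ih (N / 2) (by omega)
  have h2 := h N (N / 2 + 1) (N - N / 2) hN (by
    have : N ≤ 2 * (N / 2 + 1) := by omega
    have : (N : ℝ) ≤ 2 * ((N / 2 + 1 : ℕ) : ℝ) := by exact_mod_cast this
    linarith) (by omega)
  have e : ∑ n ∈ Finset.Icc 1 N, ee (U * (n : ℝ) ^ c) = ∑ n ∈ Finset.Icc 1 (N / 2), ee (U * (n : ℝ) ^ c)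
      + ∑ n ∈ Finset.range (N - N / 2), ee (U * ((N / 2 + 1 + n : ℕ) : ℝ) ^ c) := by
    have i1 : Finset.Icc 1 N = Finset.Ico 1 (N + 1) := by ext; simp only [Finset.mem_Icc, Finset.mem_Ico]; omega
    have i2 : Finset.Icc 1 (N / 2) = Finset.Ico 1 (N / 2 + 1) := by ext; simp only [Finset.mem_Icc, Finset.mem_Ico]; omega
    rw [i1, i2, ← Finset.sum_Ico_consecutive _ (show 1 ≤ N / 2 + 1 by omega)
      (show N / 2 + 1 ≤ N + 1 by omega)]
    congr 1
    rw [Finset.sum_Ico_eq_sum_range]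
    congr 2
    omega
  rw [e]
  refine (norm_add_le _ _).trans ?_
  have h3 : ((N / 2 : ℕ) : ℝ) ^ α ≤ (1/2) ^ α * (N : ℝ) ^ α := by
    rw [← Real.mul_rpow (by norm_num) (by positivity)]
    apply Real.rpow_le_rpow (by positivity) _ hα.le
    have : (2:ℝ) * ((N / 2 : ℕ) : ℝ) ≤ N := by exact_mod_cast (by omega : 2 * (N / 2) ≤ N)
    linarith
  have hU := abs_nonneg U
  calc _ ≤ K * |U| * ((1/2) ^ α * (N : ℝ) ^ α) + (K * (1 - (1/2 : ℝ) ^ α)) * |U| * (N : ℝ) ^ α := by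
        refine add_le_add (h1.trans ?_) (h2.trans ?_) <;> gcongr
    _ = _ := by ring

end VdC

theorem exp_sum_nc_bound (c : ℝ) (hc : 1 < c) (hcint : ∀ n : ℤ, c ≠ (n : ℝ))
    (η : ℝ) (hη : 0 < η) :
    ∃ K : ℝ, 0 < K ∧ ∀ U : ℝ, η ≤ |U| → ∀ N : ℕ, 1 ≤ N →
      ‖∑ n ∈ Finset.Icc 1 N, Complex.exp (2 * Real.pi * Complex.I * ((U * (n : ℝ) ^ c : ℝ) : ℂ))‖
        ≤ K * |U| * (N : ℝ) ^ (1 - min (Int.fract c) (1 - Int.fract c) / 2 ^ c) := by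
  obtain ⟨m, hm⟩ : ∃ m : ℕ, (m : ℤ) = ⌊c⌋ :=
    ⟨⌊c⌋.toNat, Int.toNat_of_nonneg (Int.floor_nonneg.mpr (by linarith))⟩
  set θ := Int.fract c with hθ
  have hcm : c = m + θ := by
    have := Int.floor_add_fract c
    rw [← hm] at this
    push_cast at this
    linarith
  have hθ1 : θ < 1 := Int.fract_lt_one c
  have hθ0 : 0 < θ := by
    rcases (Int.fract_nonneg c).lt_or_eq with h | h
    · exact h
    · exfalso
      apply hcint m
      push_cast
      rw [hcm, hθ, ← h]; simp
  have hm1 : 1 ≤ m := by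
    have : (1:ℤ) ≤ ⌊c⌋ := Int.le_floor.mpr (by push_cast; exact hc.le)
    omega
  have ht : (2:ℝ) ≤ 2 ^ m := by
    calc (2:ℝ) = 2 ^ 1 := by norm_num
      _ ≤ 2 ^ m := pow_le_pow_right₀ (by norm_num) hm1
  have h2c : (2:ℝ) ^ c = 2 ^ m * 2 ^ θ := by
    rw [hcm, Real.rpow_add (by norm_num), Real.rpow_natCast]
  obtain ⟨x1, x2⟩ := VdC.exps θ (2 ^ m) hθ0 hθ1 ht
  rw [← h2c] at x1 x2
  set δ := min θ (1 - θ) / 2 ^ c with hδ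
  have hδ1 : δ < 1 := by
    have : (1:ℝ) ≤ 2 ^ c := Real.one_le_rpow (by norm_num) (by linarith)
    rw [hδ, div_lt_one (by linarith)]
    exact lt_of_le_of_lt (min_le_left _ _) (by linarith)
  have e : (2:ℝ) ^ (m + 2) = 4 * 2 ^ m := by ring
  have hP := VdC.Pall m
  rw [e] at hP
  have hkc : ((m + 2 : ℕ) : ℝ) - c = 2 - θ := by rw [hcm]; push_cast; ring
  obtain ⟨C, hC, hb⟩ := VdC.block c hcint η hη (m + 2) _ _ (1 - δ)
    (by apply one_div_pos.mpr; linarith) (by rw [div_le_one] <;> linarith)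
    (by rw [div_le_one] <;> linarith)
    (by linarith) hP (by rw [hkc]; linarith) (by rw [hkc]; linarith)
  have hh : (1/2 : ℝ) ^ (1 - δ) < 1 := Real.rpow_lt_one (by norm_num) (by norm_num) (by linarith)
  refine ⟨C / (1 - (1/2) ^ (1 - δ)) + 1, ?_, ?_⟩
  · have : 0 < 1 - (1/2 : ℝ) ^ (1 - δ) := by linarith
    positivity
  · intro U hU N _
    exact VdC.dyadic c (1 - δ) C U (by linarith) hC (hb U hU) N
end

section
/- Let m ≥ 2 be an integer and c > 1 a non-integer real. Let G : {0,…,m−1} → ℂ and let f : ℕ → ℂ be a multiplicative function with |f(n)| ≤ 1 for all n and ∑_{n<N} f(n) = o(N). Then ∑_{n<N} f(n)·G(⌊n^c⌋ mod m) = o(N) as N → ∞. -/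
open Filter

namespace MOPS

/-- positive antitone null sequences that decay slower than 1/n -/
def P (d : ℕ → ℝ) : Prop :=
  Antitone d ∧ (∀ n, 0 < d n) ∧ Tendsto d atTop (nhds 0) ∧
    Tendsto (fun n : ℕ => (n : ℝ) * d n) atTop atTop

lemma norm_exp_sub (d : ℝ) (hd : 0 < d) :
    ‖Complex.exp (d * Complex.I) - 1 - d * Complex.I‖ ≤ 3 * d ^ 2 := by
  have hn : ‖(d : ℂ) * Complex.I‖ = d := by simp [abs_of_pos hd]
  by_cases h : d ≤ 1
  · have := Complex.norm_exp_sub_one_sub_id_le (x := (d : ℂ) * Complex.I) (by rw [hn]; exact h)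
    rw [hn] at this
    nlinarith [sq_nonneg d]
  · push Not at h
    calc _ ≤ ‖Complex.exp (d * Complex.I)‖ + ‖(1 : ℂ)‖ + ‖(d : ℂ) * Complex.I‖ := by
          refine (norm_sub_le _ _).trans ?_
          gcongr
          exact norm_sub_le _ _
      _ ≤ _ := by
          rw [hn, Complex.norm_exp_ofReal_mul_I, norm_one]
          nlinarith

lemma fejer_bound (a : ℕ → ℝ) (d : ℕ → ℝ) (hd : ∀ n, d n = a (n + 1) - a n)
    (hanti : Antitone d) (hpos : ∀ n, 0 < d n) (N : ℕ) :
    ‖∑ n ∈ Finset.range N, Complex.exp (a n * Complex.I)‖ ≤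
      2 * (d N)⁻¹ + 3 * ∑ n ∈ Finset.range N, d n := by
  set z : ℕ → ℂ := fun n => Complex.exp (a n * Complex.I) with hz
  have hz1 : ∀ n, ‖z n‖ = 1 := fun n => Complex.norm_exp_ofReal_mul_I _
  have hsucc : ∀ n, z (n + 1) = z n * Complex.exp (d n * Complex.I) := by
    intro n
    simp only [hz, ← Complex.exp_add, hd]
    congr 1; push_cast; ring
  set r : ℕ → ℝ := fun n => (d n)⁻¹ with hr
  have hrm : ∀ n, r n ≤ r (n + 1) := by
    intro n
    exact inv_anti₀ (hpos _) (hanti (Nat.le_succ n))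
  have hrpos : ∀ n, 0 < r n := fun n => inv_pos.2 (hpos n)
  -- summation by parts
  have parts : ∀ N, ∑ n ∈ Finset.range N, (z (n + 1) - z n) * r n =
      z N * r N - z 0 * r 0 - ∑ n ∈ Finset.range N, z (n + 1) * ((r (n + 1) - r n : ℝ) : ℂ) := by
    intro N
    induction N with
    | zero => simp
    | succ N ih =>
      rw [Finset.sum_range_succ, ih, Finset.sum_range_succ]
      push_cast; ring
  have hb1 : ‖∑ n ∈ Finset.range N, (z (n + 1) - z n) * r n‖ ≤ 2 * r N := by
    rw [parts]
    have h3 : ‖∑ n ∈ Finset.range N, z (n + 1) * ((r (n + 1) - r n : ℝ) : ℂ)‖ ≤ r N - r 0 := by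
      rw [← Finset.sum_range_sub]
      refine norm_sum_le_of_le _ fun n _ => ?_
      rw [norm_mul, hz1, one_mul, Complex.norm_real, Real.norm_eq_abs,
        abs_of_nonneg (sub_nonneg.2 (hrm n))]
    have h1 : ‖z N * r N‖ = r N := by
      rw [norm_mul, hz1, one_mul, Complex.norm_real, Real.norm_eq_abs, abs_of_pos (hrpos N)]
    have h2 : ‖z 0 * r 0‖ = r 0 := by
      rw [norm_mul, hz1, one_mul, Complex.norm_real, Real.norm_eq_abs, abs_of_pos (hrpos 0)]
    have := norm_sub_le (z N * r N - z 0 * r 0)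
      (∑ n ∈ Finset.range N, z (n + 1) * ((r (n + 1) - r n : ℝ) : ℂ))
    have := norm_sub_le (z N * r N) (z 0 * r 0)
    linarith
  have hb2 : ‖∑ n ∈ Finset.range N, ((z (n + 1) - z n) * r n - Complex.I * z n)‖ ≤
      3 * ∑ n ∈ Finset.range N, d n := by
    rw [Finset.mul_sum]
    refine norm_sum_le_of_le _ fun n _ => ?_
    have : (z (n + 1) - z n) * r n - Complex.I * z n =
        z n * (Complex.exp (d n * Complex.I) - 1 - d n * Complex.I) * r n := by
      rw [hsucc]
      have : (d n : ℂ) * (r n : ℂ) = 1 := by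
        rw [← Complex.ofReal_mul, hr]; simp [(hpos n).ne']
      linear_combination (Complex.I * z n) * this
    rw [this, norm_mul, norm_mul, hz1, one_mul, Complex.norm_real, Real.norm_eq_abs,
      abs_of_pos (hrpos n)]
    calc _ ≤ 3 * d n ^ 2 * r n := by
          gcongr
          · exact (hrpos n).le
          · exact norm_exp_sub _ (hpos n)
      _ = 3 * d n := by
          rw [hr]; have := (hpos n).ne'; field_simp
  have : ‖∑ n ∈ Finset.range N, z n‖ = ‖∑ n ∈ Finset.range N, Complex.I * z n‖ := by
    rw [← Finset.mul_sum, norm_mul, Complex.norm_I, one_mul]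
  rw [this]
  have e : ∑ n ∈ Finset.range N, Complex.I * z n = ∑ n ∈ Finset.range N, (z (n + 1) - z n) * r n
      - ∑ n ∈ Finset.range N, ((z (n + 1) - z n) * r n - Complex.I * z n) := by
    rw [← Finset.sum_sub_distrib]; congr 1; ext n; ring
  rw [e]
  exact (norm_sub_le _ _).trans (add_le_add hb1 hb2)

lemma fejer (a : ℕ → ℝ) (h : P (fun n => a (n + 1) - a n)) :
    Tendsto (fun N : ℕ => (∑ n ∈ Finset.range N, Complex.exp (a n * Complex.I)) / N)
      atTop (nhds 0) := by
  obtain ⟨h1, h2, h3, h4⟩ := h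
  set d := fun n => a (n + 1) - a n with hd
  have hc := h3.cesaro
  have hi := h4.inv_tendsto_atTop
  have : Tendsto (fun N : ℕ => 2 * ((N : ℝ) * d N)⁻¹ +
      3 * ((N : ℝ)⁻¹ * ∑ n ∈ Finset.range N, d n)) atTop (nhds 0) := by
    have := (hi.const_mul 2).add (hc.const_mul 3)
    simpa using this
  refine squeeze_zero_norm (fun N => ?_) this
  rw [norm_div, Complex.norm_natCast]
  have hb := fejer_bound a d (fun _ => rfl) h1 h2 N
  rcases Nat.eq_zero_or_pos N with rfl | hN
  · simp
  have : (0 : ℝ) < N := by exact_mod_cast hN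
  rw [div_le_iff₀ this]
  refine hb.trans (le_of_eq ?_)
  have := (h2 N).ne'
  field_simp

lemma shift_avg (u : ℕ → ℂ) (hu : ∀ n, ‖u n‖ ≤ 1) (h : ℕ) (N : ℕ) :
    ‖∑ n ∈ Finset.range N, u (n + h) - ∑ n ∈ Finset.range N, u n‖ ≤ 2 * h := by
  induction h with
  | zero => simp
  | succ h ih =>
    have e : ∑ n ∈ Finset.range N, u (n + (h + 1)) - ∑ n ∈ Finset.range N, u (n + h)
        = u (N + h) - u h := by
      rw [← Finset.sum_sub_distrib]
      have := Finset.sum_range_sub (fun n => u (n + h)) N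
      simp only [zero_add] at this
      rw [← this]
      refine Finset.sum_congr rfl fun n _ => ?_
      congr 2; ring
    have : ∑ n ∈ Finset.range N, u (n + (h + 1)) - ∑ n ∈ Finset.range N, u n =
      (u (N + h) - u h) + (∑ n ∈ Finset.range N, u (n + h) - ∑ n ∈ Finset.range N, u n) := by
      rw [← e]; ring
    rw [this]
    refine (norm_add_le _ _).trans ?_
    have := (norm_sub_le (u (N + h)) (u h)).trans (add_le_add (hu _) (hu _))
    push_cast
    linarith

lemma shift_tendsto (u : ℕ → ℂ) (hu : ∀ n, ‖u n‖ ≤ 1) (h : ℕ) :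
    Tendsto (fun N : ℕ => (∑ n ∈ Finset.range N, u (n + h)) / N - (∑ n ∈ Finset.range N, u n) / N)
      atTop (nhds 0) := by
  refine squeeze_zero_norm (a := fun N : ℕ => (2 * h : ℝ) / N) (fun N => ?_)
    (tendsto_const_div_atTop_nhds_zero_nat _)
  rw [← sub_div, norm_div, Complex.norm_natCast]
  gcongr
  exact shift_avg u hu h N

lemma shift_tendsto_zero (u : ℕ → ℂ) (hu : ∀ n, ‖u n‖ ≤ 1) (h : ℕ) :
    Tendsto (fun N : ℕ => (∑ n ∈ Finset.range N, u (n + h)) / N) atTop (nhds 0) ↔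
    Tendsto (fun N : ℕ => (∑ n ∈ Finset.range N, u n) / N) atTop (nhds 0) := by
  have := shift_tendsto u hu h
  constructor
  · intro h; simpa using h.sub this
  · intro h; simpa using h.add this

open ComplexConjugate in
lemma vdc (u : ℕ → ℂ) (hu : ∀ n, ‖u n‖ ≤ 1)
    (H : ∀ h : ℕ, 1 ≤ h → Tendsto (fun N : ℕ =>
      (∑ n ∈ Finset.range N, u (n + h) * conj (u n)) / N) atTop (nhds 0)) :
    Tendsto (fun N : ℕ => (∑ n ∈ Finset.range N, u n) / N) atTop (nhds 0) := by
  -- all off-diagonal correlations vanish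
  have off : ∀ i j : ℕ, i ≠ j → Tendsto (fun N : ℕ =>
      (∑ n ∈ Finset.range N, u (n + i) * conj (u (n + j))) / N) atTop (nhds 0) := by
    have key : ∀ i j : ℕ, j < i → Tendsto (fun N : ℕ =>
      (∑ n ∈ Finset.range N, u (n + i) * conj (u (n + j))) / N) atTop (nhds 0) := by
      intro i j hij
      have := (shift_tendsto_zero (fun n => u (n + (i - j)) * conj (u n)) (fun n => by
        rw [norm_mul, RCLike.norm_conj]
        exact mul_le_one₀ (hu _) (norm_nonneg _) (hu _)) j).2 (H (i - j) (by omega))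
      refine this.congr fun N => ?_
      congr 1
      refine Finset.sum_congr rfl fun n _ => ?_
      rw [show n + j + (i - j) = n + i by omega]
    intro i j hij
    rcases lt_or_gt_of_ne hij with h | h
    · have := (key j i h)
      have := (Complex.continuous_conj.tendsto _).comp this
      simp only [map_zero] at this
      refine this.congr fun N => ?_
      simp only [Function.comp, map_div₀, map_sum, map_mul, Complex.conj_conj, Complex.conj_natCast]
      congr 1
      refine Finset.sum_congr rfl fun n _ => ?_
      ring
    · exact key i j h
  -- Main inequality
  rw [Metric.tendsto_atTop]
  intro ε hε
  obtain ⟨K, hK⟩ := exists_nat_gt (4 / ε ^ 2)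
  have hKpos : 0 < (K : ℝ) := lt_trans (by positivity) hK
  have hK' : 4 / K < ε ^ 2 := by
    rw [div_lt_iff₀ hKpos]; rw [div_lt_iff₀ (by positivity)] at hK; linarith
  set C : ℕ → ℝ := fun N => ∑ i ∈ Finset.range K, ∑ j ∈ Finset.range K,
    if i = j then 0 else ‖(∑ n ∈ Finset.range N, u (n + i) * conj (u (n + j))) / N‖ with hC
  have hCt : Tendsto C atTop (nhds 0) := by
    have : Tendsto C atTop (nhds (∑ i ∈ Finset.range K, ∑ j ∈ Finset.range K, (0 : ℝ))) := by
      refine tendsto_finsetSum _ fun i _ => tendsto_finsetSum _ fun j _ => ?_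
      by_cases h : i = j
      · simp [h]
      · simp only [h, if_false]
        simpa using (off i j h).norm
    simpa using this
  have hsq : ∀ N : ℕ, 0 < N →
      ‖∑ i ∈ Finset.range K, (∑ n ∈ Finset.range N, u (n + i)) / N‖ ^ 2 ≤ K + C N := by
    intro N hN
    have hN' : (0 : ℝ) < N := by exact_mod_cast hN
    have e1 : ∑ i ∈ Finset.range K, (∑ n ∈ Finset.range N, u (n + i)) / (N : ℂ) =
      (∑ n ∈ Finset.range N, ∑ i ∈ Finset.range K, u (n + i)) / N := by
      rw [← Finset.sum_div, Finset.sum_comm]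
    rw [e1, norm_div, Complex.norm_natCast, div_pow]
    have cs : ‖∑ n ∈ Finset.range N, ∑ i ∈ Finset.range K, u (n + i)‖ ^ 2 ≤
        N * ∑ n ∈ Finset.range N, ‖∑ i ∈ Finset.range K, u (n + i)‖ ^ 2 := by
      calc _ ≤ (∑ n ∈ Finset.range N, ‖∑ i ∈ Finset.range K, u (n + i)‖) ^ 2 := by
            gcongr; exact norm_sum_le _ _
        _ ≤ _ := by
            have := sq_sum_le_card_mul_sum_sq (s := Finset.range N)
              (f := fun n => ‖∑ i ∈ Finset.range K, u (n + i)‖)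
            simpa using this
    have e2 : ((∑ n ∈ Finset.range N, ‖∑ i ∈ Finset.range K, u (n + i)‖ ^ 2 : ℝ) : ℂ) =
        ∑ i ∈ Finset.range K, ∑ j ∈ Finset.range K,
          ∑ n ∈ Finset.range N, u (n + i) * conj (u (n + j)) := by
      push_cast
      calc _ = ∑ n ∈ Finset.range N, ∑ i ∈ Finset.range K, ∑ j ∈ Finset.range K,
            u (n + i) * conj (u (n + j)) := by
            refine Finset.sum_congr rfl fun n _ => ?_
            rw [← Complex.mul_conj', map_sum, Finset.sum_mul_sum]
        _ = _ := by
            rw [Finset.sum_comm]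
            refine Finset.sum_congr rfl fun i _ => ?_
            rw [Finset.sum_comm]
    have e3 : ∑ n ∈ Finset.range N, ‖∑ i ∈ Finset.range K, u (n + i)‖ ^ 2 ≤ N * (K + C N) := by
      have h0 : ∑ n ∈ Finset.range N, ‖∑ i ∈ Finset.range K, u (n + i)‖ ^ 2 =
        ‖((∑ n ∈ Finset.range N, ‖∑ i ∈ Finset.range K, u (n + i)‖ ^ 2 : ℝ) : ℂ)‖ := by
        rw [Complex.norm_real, Real.norm_eq_abs, abs_of_nonneg]
        positivity
      rw [h0, e2]
      have : (N : ℝ) * (K + C N) = ∑ i ∈ Finset.range K, ∑ j ∈ Finset.range K,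
          ((if i = j then (N : ℝ) else 0) + N * (if i = j then 0 else
            ‖(∑ n ∈ Finset.range N, u (n + i) * conj (u (n + j))) / N‖)) := by
        simp only [Finset.sum_add_distrib, ← Finset.mul_sum, hC, mul_add]
        congr 1
        have : ∀ i ∈ Finset.range K, (∑ j ∈ Finset.range K, if i = j then (N : ℝ) else 0) = N := by
          intro i hi
          rw [Finset.sum_ite_eq, if_pos hi]
        rw [Finset.sum_congr rfl this]
        simp [mul_comm]
      rw [this]
      refine norm_sum_le_of_le _ fun i _ => norm_sum_le_of_le _ fun j _ => ?_
      by_cases h : i = j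
      · simp only [h, if_true]
        refine (norm_sum_le_of_le (f := fun n => u (n + j) * conj (u (n + j))) (Finset.range N)
          (n := fun _ => (1 : ℝ)) fun n _ => ?_).trans ?_
        · rw [norm_mul, RCLike.norm_conj]
          exact mul_le_one₀ (hu _) (norm_nonneg _) (hu _)
        · simp
      · simp only [h, if_false, zero_add]
        rw [norm_div, Complex.norm_natCast, mul_div_cancel₀ _ hN'.ne']
    rw [div_le_iff₀ (by positivity)]
    refine cs.trans ?_
    calc _ ≤ (N : ℝ) * (N * (K + C N)) := by gcongr
      _ = _ := by ring
  set D : ℕ → ℂ := fun N => ∑ i ∈ Finset.range K, (∑ n ∈ Finset.range N, u (n + i)) / (N : ℂ) -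
     K * ((∑ n ∈ Finset.range N, u n) / N) with hD
  have hDt : Tendsto D atTop (nhds 0) := by
    have : Tendsto (fun N : ℕ => ∑ i ∈ Finset.range K, ((∑ n ∈ Finset.range N, u (n + i)) / (N : ℂ)
       - (∑ n ∈ Finset.range N, u n) / N)) atTop (nhds (∑ i ∈ Finset.range K, 0)) :=
      tendsto_finsetSum _ fun i _ => shift_tendsto u hu i
    simp only [Finset.sum_sub_distrib, Finset.sum_const, Finset.card_range, nsmul_eq_mul,
      mul_zero] at this
    exact this
  have hlim : Tendsto (fun N => Real.sqrt (K + C N) + ‖D N‖) atTop (nhds (Real.sqrt K)) := by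
    have := ((hCt.const_add (K : ℝ)).sqrt).add hDt.norm
    simpa using this
  have hlt : Real.sqrt K < K * ε := by
    rw [Real.sqrt_lt' (by positivity)]
    rw [div_lt_iff₀ hKpos] at hK'
    nlinarith
  have hev := (hlim.eventually (gt_mem_nhds hlt)).and (eventually_gt_atTop 0)
  obtain ⟨N0, hN0⟩ := eventually_atTop.1 hev
  refine ⟨N0, fun N hN => ?_⟩
  obtain ⟨h1, h2⟩ := hN0 N hN
  rw [dist_zero_right]
  have h3 : ‖(K : ℂ) * ((∑ n ∈ Finset.range N, u n) / N)‖ ≤ Real.sqrt (K + C N) + ‖D N‖ := by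
    have : (K : ℂ) * ((∑ n ∈ Finset.range N, u n) / N) =
      ∑ i ∈ Finset.range K, (∑ n ∈ Finset.range N, u (n + i)) / (N : ℂ) - D N := by
      rw [hD]; ring
    rw [this]
    refine (norm_sub_le _ _).trans ?_
    gcongr
    exact Real.le_sqrt_of_sq_le (hsq N h2)
  rw [norm_mul, Complex.norm_natCast] at h3
  have := lt_of_le_of_lt h3 h1
  exact lt_of_mul_lt_mul_left this hKpos.le

end MOPS

namespace MOPS

lemma P_sum_shift (d : ℕ → ℝ) (hd : P d) (h : ℕ) (hh : 1 ≤ h) :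
    P (fun n => ∑ i ∈ Finset.range h, d (n + i)) := by
  obtain ⟨h1, h2, h3, h4⟩ := hd
  refine ⟨?_, ?_, ?_, ?_⟩
  · intro a b hab
    exact Finset.sum_le_sum fun i _ => h1 (by omega)
  · intro n
    exact Finset.sum_pos (fun i _ => h2 _) ⟨0, by simpa using by omega⟩
  · have : Tendsto (fun n => ∑ i ∈ Finset.range h, d (n + i)) atTop
      (nhds (∑ i ∈ Finset.range h, 0)) :=
      tendsto_finsetSum _ fun i _ => (tendsto_add_atTop_iff_nat i).2 h3
    simpa using this
  · refine tendsto_atTop_mono (fun n => ?_) h4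
    gcongr
    have := Finset.single_le_sum (f := fun i => d (n + i)) (s := Finset.range h) (a := 0)
      (fun i _ => (h2 _).le) (by simpa using by omega)
    simpa using this

open ComplexConjugate in
lemma weyl_seq (k : ℕ) : ∀ a : ℕ → ℝ, P ((fwdDiff 1)^[k + 1] a) →
    Tendsto (fun N : ℕ => (∑ n ∈ Finset.range N, Complex.exp (a n * Complex.I)) / N)
      atTop (nhds 0) := by
  induction k with
  | zero => intro a h; exact fejer a h
  | succ k ih =>
    intro a ha
    refine vdc _ (fun n => (Complex.norm_exp_ofReal_mul_I _).le) fun h hh => ?_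
    have key : P ((fwdDiff 1)^[k + 1] (fun n => a (n + h) - a n)) := by
      have e : (fun n => a (n + h) - a n) = ∑ i ∈ Finset.range h, fun n => (fwdDiff 1 a) (n + i) := by
        ext n
        simp only [Finset.sum_apply, fwdDiff]
        have := Finset.sum_range_sub (fun i => a (n + i)) h
        simp only [add_zero] at this
        rw [← this]
        rfl
      rw [e, fwdDiff_iter_finsetSum]
      rw [Function.iterate_succ_apply] at ha
      have := P_sum_shift _ ha h hh
      convert this using 1
      ext n
      simp only [Finset.sum_apply]
      refine Finset.sum_congr rfl fun i _ => ?_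
      exact fwdDiff_iter_comp_add _ _ _ _ _
    refine (ih _ key).congr fun N => ?_
    congr 1
    refine Finset.sum_congr rfl fun n _ => ?_
    rw [← Complex.exp_conj, ← Complex.exp_add]
    congr 1
    simp
    ring

lemma hasDerivAt_fwdDiff (k : ℕ) : ∀ (c : ℝ) (x : ℝ), 0 < x →
    HasDerivAt ((fwdDiff (1 : ℝ))^[k] (fun x : ℝ => x ^ c))
      (c * (fwdDiff (1 : ℝ))^[k] (fun x : ℝ => x ^ (c - 1)) x) x := by
  induction k with
  | zero =>
    intro c x hx
    exact Real.hasDerivAt_rpow_const (Or.inl hx.ne')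
  | succ k ih =>
    intro c x hx
    rw [Function.iterate_succ_apply', Function.iterate_succ_apply']
    simp only [fwdDiff, mul_sub]
    exact ((ih c (x + 1) (by linarith)).comp_add_const x 1).sub (ih c x hx)

lemma fwdDiff_mvt (k : ℕ) : ∀ (c : ℝ) (x : ℝ), 0 < x →
    ∃ ξ, x ≤ ξ ∧ ξ ≤ x + k ∧ (fwdDiff (1 : ℝ))^[k] (fun x : ℝ => x ^ c) x =
      (∏ i ∈ Finset.range k, (c - i)) * ξ ^ (c - k) := by
  induction k with
  | zero => intro c x hx; exact ⟨x, le_rfl, by simp, by simp⟩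
  | succ k ih =>
    intro c x hx
    obtain ⟨y, hy, hy2⟩ := exists_hasDerivAt_eq_slope
      ((fwdDiff (1 : ℝ))^[k] (fun x : ℝ => x ^ c))
      (fun x => c * (fwdDiff (1 : ℝ))^[k] (fun x : ℝ => x ^ (c - 1)) x) (show x < x + 1 by linarith)
      (fun z hz => (hasDerivAt_fwdDiff k c z (by linarith [hz.1])).continuousAt.continuousWithinAt)
      (fun z hz => hasDerivAt_fwdDiff k c z (by linarith [hz.1]))
    obtain ⟨ξ, h1, h2, h3⟩ := ih (c - 1) y (by linarith [hy.1])
    refine ⟨ξ, by linarith [hy.1], by push_cast; linarith [hy.2], ?_⟩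
    rw [Function.iterate_succ_apply', fwdDiff]
    have : x + 1 - x = 1 := by ring
    rw [this, div_one] at hy2
    rw [← hy2, h3, Finset.prod_range_succ']
    push_cast
    have e : ∀ i : ℕ, c - 1 - (i : ℝ) = c - (i + 1) := fun i => by ring
    simp only [e]
    rw [show c - 0 = c by ring, show c - ((k : ℝ) + 1) = c - (k + 1) by ring]
    ring

lemma fwdDiff_nat (F : ℝ → ℝ) (k : ℕ) : ∀ n : ℕ,
    (fwdDiff 1)^[k] (fun n : ℕ => F (n + 1)) n = (fwdDiff (1 : ℝ))^[k] F (n + 1) := by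
  induction k with
  | zero => intro n; rfl
  | succ k ih =>
    intro n
    rw [Function.iterate_succ_apply', Function.iterate_succ_apply', fwdDiff, fwdDiff, ih, ih]
    push_cast; rfl

lemma P_pow (c : ℝ) (hc : 1 < c) (hcint : ∀ n : ℤ, c ≠ (n : ℝ)) (γ : ℝ) (hγ : 0 < γ) :
    ∃ k : ℕ, P ((fwdDiff 1)^[k + 1] (fun n : ℕ => γ * ((n : ℝ) + 1) ^ c)) := by
  set k := ⌊c⌋₊ with hk
  have hk1 : (k : ℝ) < c := lt_of_le_of_ne (Nat.floor_le (by linarith))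
    (by have := hcint k; push_cast at this; exact this.symm)
  have hk2 : c < k + 1 := Nat.lt_floor_add_one c
  set A := ∏ i ∈ Finset.range (k + 1), (c - i) with hA
  have hApos : 0 < A := by
    refine Finset.prod_pos fun i hi => ?_
    have : (i : ℝ) ≤ k := by
      have := Finset.mem_range.1 hi
      exact_mod_cast (by omega : i ≤ k)
    linarith
  have hγA : 0 < γ * A := mul_pos hγ hApos
  refine ⟨k, ?_⟩
  set d := (fwdDiff 1)^[k + 1] (fun n : ℕ => γ * ((n : ℝ) + 1) ^ c) with hd
  have hd1 : ∀ n, d n = γ * (fwdDiff (1 : ℝ))^[k + 1] (fun x : ℝ => x ^ c) (n + 1) := by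
    intro n
    rw [← fwdDiff_nat]
    have := fwdDiff_iter_const_smul (h := (1 : ℕ)) γ (fun n : ℕ => ((n : ℝ) + 1) ^ c) (k + 1)
    have := congrFun this n
    simpa [hd, Pi.smul_def] using this
  have hd2 : ∀ n : ℕ, ∃ ξ : ℝ, (n : ℝ) + 1 ≤ ξ ∧ ξ ≤ n + 1 + (k + 1) ∧
      d n = γ * A * ξ ^ (c - (k + 1)) := by
    intro n
    obtain ⟨ξ, h1, h2, h3⟩ := fwdDiff_mvt (k + 1) c (n + 1) (by positivity)
    refine ⟨ξ, h1, by push_cast at h2; linarith, ?_⟩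
    rw [hd1, h3, ← hA]; push_cast; ring
  have hexp : c - (k + 1) ≤ 0 := by linarith
  refine ⟨antitone_nat_of_succ_le fun n => ?_, ?_, ?_, ?_⟩
  · obtain ⟨ξ, h1, h2, h3⟩ := fwdDiff_mvt (k + 1 + 1) c (n + 1) (by positivity)
    have : d (n + 1) - d n = γ * (fwdDiff (1 : ℝ))^[k + 1 + 1] (fun x : ℝ => x ^ c) (n + 1) := by
      rw [hd1, hd1, Function.iterate_succ_apply' _ (k + 1), fwdDiff]
      push_cast; ring
    rw [h3, Finset.prod_range_succ, ← hA] at this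
    have hξ : 0 ≤ ξ ^ (c - ((k + 1 + 1 : ℕ) : ℝ)) :=
      Real.rpow_nonneg (by have : (0 : ℝ) ≤ n := n.cast_nonneg
                           linarith) _
    have h4 : c - ((k + 1 : ℕ) : ℝ) ≤ 0 := by push_cast; linarith
    have h5 : γ * (A * (c - ((k + 1 : ℕ) : ℝ)) * ξ ^ (c - ((k + 1 + 1 : ℕ) : ℝ))) ≤ 0 := by
      refine mul_nonpos_of_nonneg_of_nonpos hγ.le ?_
      exact mul_nonpos_of_nonpos_of_nonneg (mul_nonpos_of_nonneg_of_nonpos hApos.le h4) hξ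
    linarith
  · intro n
    obtain ⟨ξ, h1, h2, h3⟩ := hd2 n
    rw [h3]
    have : 0 < ξ := by have : (0 : ℝ) ≤ n := n.cast_nonneg
                       linarith
    positivity
  · have ht : Tendsto (fun n : ℕ => γ * A * ((n : ℝ) + 1) ^ (c - (k + 1))) atTop (nhds 0) := by
      have h1 := tendsto_rpow_neg_atTop (y := k + 1 - c) (by linarith)
      have h2 : Tendsto (fun n : ℕ => (n : ℝ) + 1) atTop atTop :=
        tendsto_atTop_add_const_right _ _ tendsto_natCast_atTop_atTop
      have := (h1.comp h2).const_mul (γ * A)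
      simpa [Function.comp_def, neg_sub] using this
    refine squeeze_zero (fun n => ?_) (fun n => ?_) ht
    · obtain ⟨ξ, h1, h2, h3⟩ := hd2 n
      rw [h3]
      have : 0 < ξ := by have : (0 : ℝ) ≤ n := n.cast_nonneg
                         linarith
      positivity
    · obtain ⟨ξ, h1, h2, h3⟩ := hd2 n
      rw [h3]
      refine mul_le_mul_of_nonneg_left ?_ hγA.le
      exact Real.rpow_le_rpow_of_nonpos (by positivity) h1 hexp
  · -- lower bound
    have ht : Tendsto (fun n : ℕ => (γ * A * ((k : ℝ) + 3) ^ (c - (k + 1))) * (n : ℝ) ^ (c - k))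
        atTop atTop := by
      refine Tendsto.const_mul_atTop (by positivity) ?_
      exact (tendsto_rpow_atTop (by linarith)).comp tendsto_natCast_atTop_atTop
    refine tendsto_atTop_mono' _ ?_ ht
    filter_upwards [eventually_ge_atTop 1] with n hn
    have hn' : (1 : ℝ) ≤ n := by exact_mod_cast hn
    obtain ⟨ξ, h1, h2, h3⟩ := hd2 n
    rw [h3]
    have hξ : 0 < ξ := by linarith
    have h4 : ξ ≤ ((k : ℝ) + 3) * n := by
      have : (0 : ℝ) ≤ k := k.cast_nonneg
      nlinarith
    have h5 := Real.rpow_le_rpow_of_nonpos hξ h4 hexp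
    rw [Real.mul_rpow (by positivity) (by positivity)] at h5
    have h6 : (n : ℝ) ^ (c - k) = n * (n : ℝ) ^ (c - (k + 1)) := by
      rw [show c - k = 1 + (c - (k + 1)) by ring, Real.rpow_add (by linarith), Real.rpow_one]
    rw [h6]
    calc _ = n * (γ * A * (((k : ℝ) + 3) ^ (c - (k + 1)) * (n : ℝ) ^ (c - (k + 1)))) := by ring
      _ ≤ _ := by gcongr

/-- Weyl sums for `γ n ^ c`. -/
lemma weyl (c : ℝ) (hc : 1 < c) (hcint : ∀ n : ℤ, c ≠ (n : ℝ)) (γ : ℝ) (hγ : γ ≠ 0) :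
    Tendsto (fun N : ℕ => (∑ n ∈ Finset.range N,
      Complex.exp ((γ * (n : ℝ) ^ c : ℝ) * Complex.I)) / N) atTop (nhds 0) := by
  have pos : ∀ γ : ℝ, 0 < γ → Tendsto (fun N : ℕ => (∑ n ∈ Finset.range N,
      Complex.exp ((γ * (n : ℝ) ^ c : ℝ) * Complex.I)) / N) atTop (nhds 0) := by
    intro γ hγ
    obtain ⟨k, hk⟩ := P_pow c hc hcint γ hγ
    have h1 := weyl_seq k _ hk
    have h2 := shift_tendsto_zero (fun n : ℕ => Complex.exp ((γ * (n : ℝ) ^ c : ℝ) * Complex.I))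
      (fun n => (Complex.norm_exp_ofReal_mul_I _).le) 1
    refine h2.1 (h1.congr fun N => ?_)
    simp only [Nat.cast_add, Nat.cast_one]
  rcases lt_or_gt_of_ne hγ with h | h
  · have := (Complex.continuous_conj.tendsto _).comp (pos (-γ) (by linarith))
    simp only [map_zero] at this
    refine this.congr fun N => ?_
    simp only [Function.comp, map_div₀, map_sum, Complex.conj_natCast]
    congr 1
    refine Finset.sum_congr rfl fun n _ => ?_
    rw [← Complex.exp_conj]
    congr 1
    simp
  · exact pos γ h

end MOPS

namespace MOPS

section circle
variable {T : ℝ} [hT : Fact (0 < T)]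

/-- trigonometric polynomial -/
noncomputable def tp (t : ℤ →₀ ℂ) : C(AddCircle T, ℂ) := t.sum fun a z => z • fourier a

lemma tp_apply (t : ℤ →₀ ℂ) (x : AddCircle T) :
    tp t x = ∑ a ∈ t.support, t a * fourier a x := by
  simp [tp, Finsupp.sum, ContinuousMap.sum_apply]

lemma exists_tp (F : C(AddCircle T, ℂ)) (ε : ℝ) (hε : 0 < ε) :
    ∃ t : ℤ →₀ ℂ, ∀ x, ‖F x - tp t x‖ ≤ ε := by
  have h : F ∈ (Submodule.span ℂ (Set.range <| @fourier T)).topologicalClosure := by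
    rw [span_fourier_closure_eq_top]; trivial
  have h' : F ∈ closure (Submodule.span ℂ (Set.range <| @fourier T) : Set C(AddCircle T, ℂ)) := h
  obtain ⟨S, hS, hS2⟩ := Metric.mem_closure_iff.1 h' ε hε
  obtain ⟨t, ht⟩ := Finsupp.mem_span_range_iff_exists_finsupp.1 hS
  refine ⟨t, fun x => ?_⟩
  have e : tp t = S := ht
  rw [e]
  rw [dist_eq_norm] at hS2
  exact ((F - S).norm_coe_le_norm x).trans hS2.le

lemma integral_fourier (a : ℤ) :
    ∫ x, (fourier a x : ℂ) ∂(AddCircle.haarAddCircle (T := T)) = if a = 0 then 1 else 0 := by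
  split_ifs with h
  · simp [h]
  · exact MeasureTheory.integral_eq_zero_of_add_right_eq_neg
      (fourier_add_half_inv_index h hT.elim)

lemma integrable_cont (F : C(AddCircle T, ℂ)) :
    MeasureTheory.Integrable F (AddCircle.haarAddCircle (T := T)) :=
  F.continuous.integrable_of_hasCompactSupport (HasCompactSupport.of_compactSpace _)

lemma integral_tp (t : ℤ →₀ ℂ) : ∫ x, tp t x ∂(AddCircle.haarAddCircle (T := T)) = t 0 := by
  simp only [tp_apply]
  rw [MeasureTheory.integral_finsetSum]
  · simp only [MeasureTheory.integral_const_mul, integral_fourier]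
    simp only [mul_ite, mul_one, mul_zero, Finset.sum_ite_eq', Finsupp.mem_support_iff, ne_eq,
      ite_not, ite_eq_right_iff]
    exact fun h => h.symm
  · intro a _
    exact (integrable_cont (fourier a)).const_mul _

lemma integral_close (F S : C(AddCircle T, ℂ)) (ε : ℝ) (h : ∀ x, ‖F x - S x‖ ≤ ε) :
    ‖∫ x, F x ∂(AddCircle.haarAddCircle (T := T)) -
      ∫ x, S x ∂(AddCircle.haarAddCircle (T := T))‖ ≤ ε := by
  rw [← MeasureTheory.integral_sub (integrable_cont F) (integrable_cont S)]
  have := MeasureTheory.norm_integral_le_of_norm_le_const (μ := AddCircle.haarAddCircle (T := T))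
    (Eventually.of_forall h)
  simpa using this

lemma weyl_two (c : ℝ) (hc : 1 < c) (hcint : ∀ n : ℤ, c ≠ (n : ℝ))
    (a b : ℤ) (α β : ℝ) (h : a * α ≠ b * β) :
    Tendsto (fun N : ℕ => (∑ n ∈ Finset.range N,
      fourier a ((α * (n : ℝ) ^ c : ℝ) : AddCircle T) *
        (starRingEnd ℂ) (fourier b ((β * (n : ℝ) ^ c : ℝ) : AddCircle T))) / (N : ℂ))
      atTop (nhds 0) := by
  have hT0 : T ≠ 0 := hT.out.ne'
  have := weyl c hc hcint (2 * Real.pi * (a * α - b * β) / T)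
    (by have := Real.pi_ne_zero
        have := sub_ne_zero.2 h
        positivity)
  refine this.congr fun N => ?_
  congr 1
  refine Finset.sum_congr rfl fun n _ => ?_
  rw [← fourier_neg, fourier_coe_apply, fourier_coe_apply, ← Complex.exp_add]
  congr 1
  push_cast
  have : (T : ℂ) ≠ 0 := by exact_mod_cast hT0
  field_simp
  ring

lemma weyl_one (c : ℝ) (hc : 1 < c) (hcint : ∀ n : ℤ, c ≠ (n : ℝ))
    (a : ℤ) (α : ℝ) (hα : α ≠ 0) (h : a ≠ 0) :
    Tendsto (fun N : ℕ => (∑ n ∈ Finset.range N,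
      fourier a ((α * (n : ℝ) ^ c : ℝ) : AddCircle T)) / (N : ℂ)) atTop (nhds 0) := by
  have := weyl_two (T := T) c hc hcint a 0 α α (by simp [h, hα])
  simpa using this

lemma avg_one : Tendsto (fun N : ℕ => (∑ n ∈ Finset.range N, (1 : ℂ)) / (N : ℂ)) atTop (nhds 1) := by
  refine tendsto_const_nhds.congr' ?_
  filter_upwards [eventually_gt_atTop 0] with N hN
  have : (N : ℂ) ≠ 0 := by exact_mod_cast hN.ne'
  simp [this]

lemma tp_equi (c : ℝ) (hc : 1 < c) (hcint : ∀ n : ℤ, c ≠ (n : ℝ))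
    (t : ℤ →₀ ℂ) (α : ℝ) (hα : α ≠ 0) :
    Tendsto (fun N : ℕ => (∑ n ∈ Finset.range N,
      tp t ((α * (n : ℝ) ^ c : ℝ) : AddCircle T)) / (N : ℂ)) atTop (nhds (t 0)) := by
  have h : Tendsto (fun N : ℕ => ∑ a ∈ t.support, t a * ((∑ n ∈ Finset.range N,
      fourier a ((α * (n : ℝ) ^ c : ℝ) : AddCircle T)) / (N : ℂ))) atTop
      (nhds (∑ a ∈ t.support, t a * (if a = 0 then 1 else 0))) := by
    refine tendsto_finsetSum _ fun a _ => Tendsto.const_mul _ ?_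
    split_ifs with ha
    · simp only [ha, fourier_zero]
      exact avg_one
    · exact weyl_one c hc hcint a α hα ha
  have e : (∑ a ∈ t.support, t a * (if a = 0 then 1 else 0)) = t 0 := by
    simp only [mul_ite, mul_one, mul_zero, Finset.sum_ite_eq', Finsupp.mem_support_iff, ne_eq,
      ite_not, ite_eq_right_iff]
    exact fun h => h.symm
  rw [e] at h
  refine h.congr fun N => ?_
  simp only [tp_apply]
  rw [Finset.sum_comm, Finset.sum_div]
  refine Finset.sum_congr rfl fun a _ => ?_
  rw [← Finset.mul_sum, mul_div_assoc]

lemma equi (c : ℝ) (hc : 1 < c) (hcint : ∀ n : ℤ, c ≠ (n : ℝ))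
    (F : C(AddCircle T, ℂ)) (α : ℝ) (hα : α ≠ 0) :
    Tendsto (fun N : ℕ => (∑ n ∈ Finset.range N,
      F ((α * (n : ℝ) ^ c : ℝ) : AddCircle T)) / (N : ℂ)) atTop
      (nhds (∫ x, F x ∂(AddCircle.haarAddCircle (T := T)))) := by
  rw [Metric.tendsto_atTop]
  intro ε hε
  obtain ⟨t, ht⟩ := exists_tp F (ε / 3) (by positivity)
  obtain ⟨N0, hN0⟩ := Metric.tendsto_atTop.1 (tp_equi (T := T) c hc hcint t α hα) (ε / 3)
    (by positivity)
  refine ⟨N0, fun N hN => ?_⟩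
  have h1 := hN0 N hN
  have h2 := integral_close F (tp t) _ ht
  rw [integral_tp] at h2
  rw [dist_eq_norm] at h1 ⊢
  have h3 : ‖(∑ n ∈ Finset.range N, F ((α * (n : ℝ) ^ c : ℝ) : AddCircle T)) / (N : ℂ) -
      (∑ n ∈ Finset.range N, tp t ((α * (n : ℝ) ^ c : ℝ) : AddCircle T)) / (N : ℂ)‖ ≤ ε / 3 := by
    rw [← sub_div, ← Finset.sum_sub_distrib, norm_div, Complex.norm_natCast]
    refine div_le_of_le_mul₀ (by positivity) (by positivity) ?_
    refine (norm_sum_le_of_le _ fun n _ => ht _).trans ?_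
    simp [mul_comm]
  set A := (∑ n ∈ Finset.range N, F ((α * (n : ℝ) ^ c : ℝ) : AddCircle T)) / (N : ℂ)
  set B := (∑ n ∈ Finset.range N, tp t ((α * (n : ℝ) ^ c : ℝ) : AddCircle T)) / (N : ℂ)
  set I := ∫ x, F x ∂(AddCircle.haarAddCircle (T := T))
  have : A - I = (A - B) + (B - t 0) - (I - t 0) := by ring
  rw [this]
  have := norm_sub_le ((A - B) + (B - t 0)) (I - t 0)
  have := norm_add_le (A - B) (B - t 0)
  linarith

lemma tp_corr (c : ℝ) (hc : 1 < c) (hcint : ∀ n : ℤ, c ≠ (n : ℝ))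
    (t : ℤ →₀ ℂ) (α β : ℝ) (h : ∀ a ∈ t.support, ∀ b ∈ t.support,
      ¬ (a = 0 ∧ b = 0) → a * α ≠ b * β) :
    Tendsto (fun N : ℕ => (∑ n ∈ Finset.range N,
      tp t ((α * (n : ℝ) ^ c : ℝ) : AddCircle T) *
        (starRingEnd ℂ) (tp t ((β * (n : ℝ) ^ c : ℝ) : AddCircle T))) / (N : ℂ)) atTop
      (nhds (t 0 * (starRingEnd ℂ) (t 0))) := by
  have h1 : Tendsto (fun N : ℕ => ∑ a ∈ t.support, ∑ b ∈ t.support,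
      t a * (starRingEnd ℂ) (t b) * ((∑ n ∈ Finset.range N,
      fourier a ((α * (n : ℝ) ^ c : ℝ) : AddCircle T) *
        (starRingEnd ℂ) (fourier b ((β * (n : ℝ) ^ c : ℝ) : AddCircle T))) / (N : ℂ))) atTop
      (nhds (∑ a ∈ t.support, ∑ b ∈ t.support, t a * (starRingEnd ℂ) (t b) *
        (if a = 0 then (if b = 0 then 1 else 0) else 0))) := by
    refine tendsto_finsetSum _ fun a ha => tendsto_finsetSum _ fun b hb => Tendsto.const_mul _ ?_
    by_cases hab : a = 0 ∧ b = 0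
    · simp only [hab.1, hab.2, fourier_zero, if_true, map_one, mul_one]
      exact avg_one
    · have e : (if a = 0 then (if b = 0 then (1 : ℂ) else 0) else 0) = 0 := by
        split_ifs with h1 h2
        · exact absurd ⟨h1, h2⟩ hab
        · rfl
        · rfl
      rw [e]
      exact weyl_two c hc hcint a b α β (h a ha b hb hab)
  have e : (∑ a ∈ t.support, ∑ b ∈ t.support, t a * (starRingEnd ℂ) (t b) *
        (if a = 0 then (if b = 0 then 1 else 0) else 0)) = t 0 * (starRingEnd ℂ) (t 0) := by
    by_cases h0 : t 0 = 0
    · rw [h0, zero_mul]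
      refine Finset.sum_eq_zero fun a _ => Finset.sum_eq_zero fun b _ => ?_
      split_ifs with h1 h2
      · simp [h1, h0]
      · simp
      · simp
    · have hm : (0 : ℤ) ∈ t.support := Finsupp.mem_support_iff.2 h0
      rw [Finset.sum_eq_single_of_mem 0 hm, Finset.sum_eq_single_of_mem 0 hm]
      · simp
      · intro b _ hb; simp [hb]
      · intro b _ hb; simp [hb]
  rw [e] at h1
  refine h1.congr fun N => ?_
  simp only [tp_apply, map_sum, Finset.sum_mul_sum]
  symm
  rw [Finset.sum_comm, Finset.sum_div]
  refine Finset.sum_congr rfl fun a _ => ?_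
  rw [Finset.sum_comm, Finset.sum_div]
  refine Finset.sum_congr rfl fun b _ => ?_
  rw [← mul_div_assoc, Finset.mul_sum]
  congr 1
  refine Finset.sum_congr rfl fun n _ => ?_
  rw [map_mul]; ring

end circle

end MOPS

namespace MOPS

section approx
variable (m : ℕ) [NeZero m]

instance factpos : Fact (0 < (m : ℝ)) := ⟨by exact_mod_cast Nat.pos_of_ne_zero (NeZero.ne m)⟩

/-- real bump around the integers -/
noncomputable def bump (L : ℕ) (y : ℝ) : ℝ := ((1 + Real.cos (2 * Real.pi * y)) / 2) ^ L

noncomputable def kap (L : ℕ) : C(AddCircle (m : ℝ), ℂ) :=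
  ((1 / 4 : ℂ) • ((2 : ℂ) • (1 : C(AddCircle (m : ℝ), ℂ)) + fourier (m : ℤ) + fourier (-(m : ℤ)))) ^ L

lemma kap_coe (L : ℕ) (y : ℝ) : kap m L (y : AddCircle (m : ℝ)) = (bump L y : ℝ) := by
  have hm : (m : ℂ) ≠ 0 := by exact_mod_cast NeZero.ne m
  simp only [kap, bump, ContinuousMap.pow_apply, ContinuousMap.smul_apply, ContinuousMap.add_apply,
    ContinuousMap.one_apply, fourier_coe_apply, smul_eq_mul]
  push_cast
  congr 1
  rw [Complex.cos]
  have e1 : 2 * (Real.pi : ℂ) * Complex.I * m * y / m = 2 * Real.pi * y * Complex.I := by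
    field_simp
  have e2 : 2 * (Real.pi : ℂ) * Complex.I * (-m) * y / m = -(2 * Real.pi * y) * Complex.I := by
    field_simp
  rw [e1, e2]
  ring

lemma bump_base (y : ℝ) : 0 ≤ (1 + Real.cos (2 * Real.pi * y)) / 2 ∧
    (1 + Real.cos (2 * Real.pi * y)) / 2 ≤ 1 := by
  have h1 := Real.neg_one_le_cos (2 * Real.pi * y)
  have h2 := Real.cos_le_one (2 * Real.pi * y)
  constructor <;> linarith

lemma bump_nonneg (L : ℕ) (y : ℝ) : 0 ≤ bump L y := pow_nonneg (bump_base y).1 _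
lemma bump_le (L : ℕ) (y : ℝ) : bump L y ≤ 1 := pow_le_one₀ (bump_base y).1 (bump_base y).2

lemma bump_int (L : ℕ) (n : ℤ) : bump L n = 1 := by
  have : Real.cos (2 * Real.pi * n) = 1 := by
    rw [mul_comm]; exact Real.cos_int_mul_two_pi n
  rw [bump, this]; norm_num

lemma bump_add_nat (L : ℕ) (y : ℝ) (n : ℕ) : bump L (y + n) = bump L y := by
  have : Real.cos (2 * Real.pi * (y + n)) = Real.cos (2 * Real.pi * y) := by
    rw [mul_add, mul_comm (2 * Real.pi) (n : ℝ)]; exact Real.cos_add_nat_mul_two_pi _ n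
  rw [bump, this, bump]

lemma bump_cont (L : ℕ) : Continuous (bump L) := by
  unfold bump; fun_prop

lemma kap_integral : Tendsto (fun L => ∫ x, kap m L x ∂(AddCircle.haarAddCircle (T := (m : ℝ))))
    atTop (nhds 0) := by
  have key : Tendsto (fun L => ∫ y in (0 : ℝ)..0 + m, ((bump L y : ℝ) : ℂ)) atTop
      (nhds (∫ _ in (0 : ℝ)..0 + m, (0 : ℂ))) := by
    refine intervalIntegral.tendsto_integral_filter_of_dominated_convergence (fun _ => 1) ?_ ?_ ?_ ?_
    · refine Eventually.of_forall fun L => ?_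
      exact (Complex.continuous_ofReal.comp (bump_cont L)).aestronglyMeasurable
    · refine Eventually.of_forall fun L => Eventually.of_forall fun y _ => ?_
      rw [Complex.norm_real, Real.norm_eq_abs, abs_of_nonneg (bump_nonneg L y)]
      exact bump_le L y
    · exact intervalIntegrable_const
    · have hcount : (Set.range (fun n : ℤ => (n : ℝ))).Countable := Set.countable_range _
      have := hcount.ae_notMem MeasureTheory.volume
      filter_upwards [this] with y hy _
      have h0 : Tendsto (fun L => bump L y) atTop (nhds 0) := by
        refine tendsto_pow_atTop_nhds_zero_of_lt_one (bump_base y).1 ?_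
        refine lt_of_le_of_ne (bump_base y).2 fun h => hy ?_
        have : Real.cos (2 * Real.pi * y) = 1 := by linarith
        obtain ⟨k, hk⟩ := (Real.cos_eq_one_iff _).1 this
        refine ⟨k, ?_⟩
        have := Real.pi_pos
        simp only
        nlinarith
      have := (Complex.continuous_ofReal.tendsto _).comp h0
      simpa [Function.comp_def] using this
  have e : ∀ L, ∫ x, kap m L x ∂(AddCircle.haarAddCircle (T := (m : ℝ))) =
      (m : ℝ)⁻¹ • ∫ y in (0 : ℝ)..0 + m, ((bump L y : ℝ) : ℂ) := by
    intro L
    rw [AddCircle.integral_haarAddCircle, ← AddCircle.intervalIntegral_preimage (m : ℝ) 0]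
    simp only [kap_coe]
  simp only [e]
  have := key.const_smul ((m : ℝ)⁻¹)
  simpa using this

variable (G : ZMod m → ℂ)

lemma periodic_G (L : ℕ) : Function.Periodic
    (fun y : ℝ => G ((⌊y⌋ : ℤ) : ZMod m) * ((1 - bump L y : ℝ) : ℂ)) (m : ℝ) := by
  intro y
  simp only [bump_add_nat, Int.floor_add_natCast]
  simp

lemma cont_G (hG : ∀ x, ‖G x‖ ≤ 1) (L : ℕ) :
    Continuous (fun y : ℝ => G ((⌊y⌋ : ℤ) : ZMod m) * ((1 - bump L y : ℝ) : ℂ)) := by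
  have hb : Continuous (fun y : ℝ => ((1 - bump L y : ℝ) : ℂ)) :=
    Complex.continuous_ofReal.comp (continuous_const.sub (bump_cont L))
  rw [continuous_iff_continuousAt]
  intro y
  by_cases hy : (⌊y⌋ : ℝ) = y
  · have h0 : ((1 - bump L y : ℝ) : ℂ) = 0 := by
      rw [← hy, bump_int]; simp
    have hv : G ((⌊y⌋ : ℤ) : ZMod m) * ((1 - bump L y : ℝ) : ℂ) = 0 := by rw [h0, mul_zero]
    change Tendsto _ (nhds y) (nhds (G ((⌊y⌋ : ℤ) : ZMod m) * ((1 - bump L y : ℝ) : ℂ)))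
    rw [hv]
    have ht : Tendsto (fun y : ℝ => ((1 - bump L y : ℝ) : ℂ)) (nhds y)
      (nhds ((1 - bump L y : ℝ) : ℂ)) := hb.tendsto y
    rw [h0] at ht
    have hn := ht.norm
    rw [norm_zero] at hn
    refine squeeze_zero_norm (fun z => ?_) hn
    rw [norm_mul]
    exact mul_le_of_le_one_left (norm_nonneg _) (hG _)
  · have hlt : (⌊y⌋ : ℝ) < y := lt_of_le_of_ne (Int.floor_le y) hy
    have hev : ∀ᶠ z in nhds y, ⌊z⌋ = ⌊y⌋ := by
      filter_upwards [Ioo_mem_nhds hlt (Int.lt_floor_add_one y)] with z hz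
      exact Int.floor_eq_iff.2 ⟨hz.1.le, hz.2⟩
    have : ContinuousAt (fun z : ℝ => G ((⌊y⌋ : ℤ) : ZMod m) * ((1 - bump L z : ℝ) : ℂ)) y :=
      (continuous_const.mul hb).continuousAt
    refine this.congr ?_
    filter_upwards [hev] with z hz
    rw [hz]

noncomputable def phi (hG : ∀ x, ‖G x‖ ≤ 1) (L : ℕ) : C(AddCircle (m : ℝ), ℂ) where
  toFun := (periodic_G m G L).lift
  continuous_toFun := by
    refine (QuotientAddGroup.isQuotientMap_mk _).continuous_iff.2 ?_
    exact cont_G m G hG L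

lemma phi_coe (hG : ∀ x, ‖G x‖ ≤ 1) (L : ℕ) (y : ℝ) :
    phi m G hG L (y : AddCircle (m : ℝ)) = G ((⌊y⌋ : ℤ) : ZMod m) * ((1 - bump L y : ℝ) : ℂ) :=
  rfl

lemma phi_integral (hG : ∀ x, ‖G x‖ ≤ 1) (hG0 : ∑ x, G x = 0) (L : ℕ) :
    ∫ x, phi m G hG L x ∂(AddCircle.haarAddCircle (T := (m : ℝ))) = 0 := by
  have h1 : ∀ j : ZMod m, ∫ x, phi m G hG L (x + ((j.val : ℝ) : AddCircle (m : ℝ)))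
      ∂(AddCircle.haarAddCircle (T := (m : ℝ))) =
      ∫ x, phi m G hG L x ∂(AddCircle.haarAddCircle (T := (m : ℝ))) := fun j =>
    MeasureTheory.integral_add_right_eq_self _ _
  have h2 : ∑ j : ZMod m, ∫ x, phi m G hG L (x + ((j.val : ℝ) : AddCircle (m : ℝ)))
      ∂(AddCircle.haarAddCircle (T := (m : ℝ))) = 0 := by
    rw [← MeasureTheory.integral_finsetSum]
    · refine (MeasureTheory.integral_congr_ae (g := fun _ => 0) (Eventually.of_forall fun x => ?_)).trans (by simp)
      obtain ⟨y, rfl⟩ := QuotientAddGroup.mk_surjective x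
      show ∑ j : ZMod m, phi m G hG L (((y : ℝ) : AddCircle (m : ℝ)) + ((j.val : ℝ) : AddCircle (m : ℝ))) = 0
      have : ∀ j : ZMod m, phi m G hG L (((y : ℝ) : AddCircle (m : ℝ)) + ((j.val : ℝ) : AddCircle (m : ℝ)))
          = G (((⌊y⌋ : ℤ) : ZMod m) + j) * ((1 - bump L y : ℝ) : ℂ) := by
        intro j
        rw [← AddCircle.coe_add, phi_coe, bump_add_nat, Int.floor_add_natCast]
        simp
      simp only [this]
      rw [← Finset.sum_mul]
      have : ∑ j : ZMod m, G (((⌊y⌋ : ℤ) : ZMod m) + j) = ∑ j, G j :=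
        Fintype.sum_equiv (Equiv.addLeft ((⌊y⌋ : ℤ) : ZMod m)) _ _ (fun j => rfl)
      rw [this, hG0, zero_mul]
    · intro j _
      exact integrable_cont ((phi m G hG L).comp ⟨fun x => x + ((j.val : ℝ) : AddCircle (m : ℝ)), by fun_prop⟩)
  simp only [h1] at h2
  simp only [Finset.sum_const, Finset.card_univ, ZMod.card, nsmul_eq_mul] at h2
  have hm : (m : ℂ) ≠ 0 := by exact_mod_cast NeZero.ne m
  exact (mul_eq_zero.1 h2).resolve_left hm

lemma approx (c : ℝ) (hc : 1 < c) (hcint : ∀ n : ℤ, c ≠ (n : ℝ))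
    (hG : ∀ x, ‖G x‖ ≤ 1) (hG0 : ∑ x, G x = 0) (ε : ℝ) (hε : 0 < ε) (hε1 : ε ≤ 1) :
    ∃ t : ℤ →₀ ℂ, ‖t 0‖ ≤ ε ∧ (∀ x : AddCircle (m : ℝ), ‖tp t x‖ ≤ 2) ∧
      ∀ α : ℝ, α ≠ 0 → ∀ᶠ N : ℕ in atTop, ∑ n ∈ Finset.range N,
        ‖G ((⌊α * (n : ℝ) ^ c⌋ : ℤ) : ZMod m) - tp t ((α * (n : ℝ) ^ c : ℝ) : AddCircle (m : ℝ))‖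
          ≤ ε * N := by
  obtain ⟨L, hL⟩ := ((kap_integral m).norm.eventually
    (gt_mem_nhds (show ‖(0 : ℂ)‖ < ε / 2 by simpa using hε))).exists
  obtain ⟨t, ht⟩ := exists_tp (phi m G hG L) (ε / 2) (by positivity)
  have hphi : ∀ x : AddCircle (m : ℝ), ‖phi m G hG L x‖ ≤ 1 := by
    intro x
    obtain ⟨y, rfl⟩ := QuotientAddGroup.mk_surjective x
    refine (congrArg norm (phi_coe m G hG L y)).le.trans ?_
    rw [norm_mul, Complex.norm_real, Real.norm_eq_abs]
    refine mul_le_one₀ (hG _) (abs_nonneg _) ?_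
    rw [abs_le]
    constructor <;> linarith [bump_nonneg L y, bump_le L y]
  refine ⟨t, ?_, ?_, ?_⟩
  · have := integral_close (phi m G hG L) (tp t) _ ht
    rw [phi_integral m G hG hG0, integral_tp, zero_sub, norm_neg] at this
    linarith
  · intro x
    have h1 := ht x
    have h2 := hphi x
    have h3 := norm_sub_le (phi m G hG L x) (phi m G hG L x - tp t x)
    rw [sub_sub_cancel] at h3
    linarith
  · intro α hα
    have hk := (equi c hc hcint (kap m L) α hα).norm
    filter_upwards [hk.eventually (gt_mem_nhds hL), eventually_gt_atTop 0] with N hN hN0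
    have hN' : (0 : ℝ) < N := by exact_mod_cast hN0
    have e : ∑ n ∈ Finset.range N, kap m L ((α * (n : ℝ) ^ c : ℝ) : AddCircle (m : ℝ)) =
        ((∑ n ∈ Finset.range N, bump L (α * (n : ℝ) ^ c) : ℝ) : ℂ) := by
      simp only [kap_coe]; push_cast; rfl
    rw [e, norm_div, Complex.norm_natCast, Complex.norm_real, Real.norm_eq_abs, abs_of_nonneg
      (Finset.sum_nonneg fun n _ => bump_nonneg L _), div_lt_iff₀ hN'] at hN
    calc _ ≤ ∑ n ∈ Finset.range N, (bump L (α * (n : ℝ) ^ c) + ε / 2) := by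
          refine Finset.sum_le_sum fun n _ => ?_
          set y := α * (n : ℝ) ^ c
          have h1 := ht (y : AddCircle (m : ℝ))
          have h2 : ‖G ((⌊y⌋ : ℤ) : ZMod m) - phi m G hG L (y : AddCircle (m : ℝ))‖ ≤ bump L y := by
            rw [phi_coe]
            have : G ((⌊y⌋ : ℤ) : ZMod m) - G ((⌊y⌋ : ℤ) : ZMod m) * ((1 - bump L y : ℝ) : ℂ) =
              G ((⌊y⌋ : ℤ) : ZMod m) * (bump L y : ℝ) := by push_cast; ring
            rw [this, norm_mul, Complex.norm_real, Real.norm_eq_abs, abs_of_nonneg (bump_nonneg L y)]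
            exact mul_le_of_le_one_left (bump_nonneg L y) (hG _)
          have h3 := norm_sub_le_norm_sub_add_norm_sub (G ((⌊y⌋ : ℤ) : ZMod m))
            (phi m G hG L (y : AddCircle (m : ℝ))) (tp t (y : AddCircle (m : ℝ)))
          linarith
      _ ≤ ε * N := by
          rw [Finset.sum_add_distrib]
          simp only [Finset.sum_const, Finset.card_range, nsmul_eq_mul]
          linarith

end approx

lemma ratio_bad (c : ℝ) (hc : 1 < c) (a b : ℤ) (hab : ¬ (a = 0 ∧ b = 0)) :
    ∃ P0 : ℕ, ∀ p q : ℕ, p.Prime → q.Prime → p ≠ q → P0 < p → P0 < q →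
      (a : ℝ) * (p : ℝ) ^ c ≠ b * (q : ℝ) ^ c := by
  by_cases h : ∃ p0 q0 : ℕ, p0.Prime ∧ q0.Prime ∧ p0 ≠ q0 ∧ (a : ℝ) * (p0 : ℝ) ^ c = b * (q0 : ℝ) ^ c
  · obtain ⟨p0, q0, hp0, hq0, hne0, h0⟩ := h
    refine ⟨p0, fun p q hp hq hne hpp hqq heq => ?_⟩
    have pos : ∀ r : ℕ, r.Prime → (0 : ℝ) < (r : ℝ) ^ c := fun r hr =>
      Real.rpow_pos_of_pos (by exact_mod_cast hr.pos) _
    have ha : (a : ℝ) ≠ 0 := by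
      intro ha
      rw [ha, zero_mul] at h0
      have hb : (b : ℝ) = 0 := (mul_eq_zero.1 h0.symm).resolve_right (pos q0 hq0).ne'
      exact hab ⟨by exact_mod_cast ha, by exact_mod_cast hb⟩
    have hb : (b : ℝ) ≠ 0 := by
      intro hb
      rw [hb, zero_mul] at h0
      exact ha ((mul_eq_zero.1 h0).resolve_right (pos p0 hp0).ne')
    have h1 : (p : ℝ) ^ c * (q0 : ℝ) ^ c = (p0 : ℝ) ^ c * (q : ℝ) ^ c := by
      have : ((a : ℝ) * b) * ((p : ℝ) ^ c * (q0 : ℝ) ^ c) = (a * b) * ((p0 : ℝ) ^ c * (q : ℝ) ^ c) := by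
        calc _ = (a * (p : ℝ) ^ c) * (b * (q0 : ℝ) ^ c) := by ring
          _ = (b * (q : ℝ) ^ c) * (a * (p0 : ℝ) ^ c) := by rw [heq, h0]
          _ = _ := by ring
      exact mul_left_cancel₀ (mul_ne_zero ha hb) this
    rw [← Real.mul_rpow (by positivity) (by positivity),
      ← Real.mul_rpow (by positivity) (by positivity)] at h1
    have h2 : (p : ℝ) * q0 = p0 * q :=
      (Real.rpow_left_inj (by positivity) (by positivity) (by linarith)).1 h1
    have h3 : p * q0 = p0 * q := by exact_mod_cast h2
    have h4 : p ∣ p0 * q := ⟨q0, h3.symm⟩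
    rcases (Nat.Prime.dvd_mul hp).1 h4 with h5 | h5
    · exact absurd (Nat.le_of_dvd hp0.pos h5) (by omega)
    · exact hne ((Nat.prime_dvd_prime_iff_eq hp hq).1 h5)
  · push Not at h
    exact ⟨0, fun p q hp hq hne _ _ => h p q hp hq hne⟩

lemma corr (m : ℕ) [NeZero m] (G : ZMod m → ℂ) (c : ℝ) (hc : 1 < c)
    (hcint : ∀ n : ℤ, c ≠ (n : ℝ))
    (hG : ∀ x, ‖G x‖ ≤ 1) (hG0 : ∑ x, G x = 0) (ε : ℝ) (hε : 0 < ε) (hε1 : ε ≤ 1) :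
    ∃ P0 : ℕ, ∀ p q : ℕ, p.Prime → q.Prime → p ≠ q → P0 < p → P0 < q → ∀ᶠ N : ℕ in atTop,
      ‖∑ n ∈ Finset.range N, G ((⌊((p * n : ℕ) : ℝ) ^ c⌋ : ℤ) : ZMod m) *
        (starRingEnd ℂ) (G ((⌊((q * n : ℕ) : ℝ) ^ c⌋ : ℤ) : ZMod m))‖ ≤ ε * N := by
  obtain ⟨t, ht0, ht2, ht⟩ := approx m G c hc hcint hG hG0 (ε / 5) (by positivity) (by linarith)
  choose! R hR using ratio_bad c hc
  refine ⟨∑ a ∈ t.support, ∑ b ∈ t.support, R a b, fun p q hp hq hne hpP hqP => ?_⟩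
  have hle : ∀ a ∈ t.support, ∀ b ∈ t.support, R a b ≤ ∑ a ∈ t.support, ∑ b ∈ t.support, R a b := by
    intro a ha b hb
    refine (Finset.single_le_sum (f := fun b => R a b) (fun _ _ => Nat.zero_le _) hb).trans ?_
    exact Finset.single_le_sum (f := fun a => ∑ b ∈ t.support, R a b) (fun _ _ => Nat.zero_le _) ha
  set α := (p : ℝ) ^ c with hα
  set β := (q : ℝ) ^ c with hβ
  have hα0 : α ≠ 0 := (Real.rpow_pos_of_pos (by exact_mod_cast hp.pos) _).ne'
  have hβ0 : β ≠ 0 := (Real.rpow_pos_of_pos (by exact_mod_cast hq.pos) _).ne'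
  have hcorr := (tp_corr (T := (m : ℝ)) c hc hcint t α β (fun a ha b hb hab =>
    hR a b hab p q hp hq hne (lt_of_le_of_lt (hle a ha b hb) hpP)
      (lt_of_le_of_lt (hle a ha b hb) hqP))).norm
  have hlim : ‖t 0 * (starRingEnd ℂ) (t 0)‖ < 2 * ε / 5 := by
    rw [norm_mul, RCLike.norm_conj]
    have := norm_nonneg (t 0)
    nlinarith
  filter_upwards [hcorr.eventually (gt_mem_nhds hlim), ht α hα0, ht β hβ0, eventually_gt_atTop 0]
    with N h1 h2 h3 h4
  have hN' : (0 : ℝ) < N := by exact_mod_cast h4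
  rw [norm_div, Complex.norm_natCast, div_lt_iff₀ hN'] at h1
  simp only [Nat.cast_mul, Real.mul_rpow (Nat.cast_nonneg _) (Nat.cast_nonneg _), ← hα, ← hβ]
  set X : ℕ → ℂ := fun n => G ((⌊α * (n : ℝ) ^ c⌋ : ℤ) : ZMod m)
  set Y : ℕ → ℂ := fun n => G ((⌊β * (n : ℝ) ^ c⌋ : ℤ) : ZMod m)
  set X' : ℕ → ℂ := fun n => tp t ((α * (n : ℝ) ^ c : ℝ) : AddCircle (m : ℝ))
  set Y' : ℕ → ℂ := fun n => tp t ((β * (n : ℝ) ^ c : ℝ) : AddCircle (m : ℝ))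
  have h5 : ‖∑ n ∈ Finset.range N, (X n * (starRingEnd ℂ) (Y n) - X' n * (starRingEnd ℂ) (Y' n))‖ ≤
      ∑ n ∈ Finset.range N, (‖X n - X' n‖ + 2 * ‖Y n - Y' n‖) := by
    refine norm_sum_le_of_le _ fun n _ => ?_
    have : X n * (starRingEnd ℂ) (Y n) - X' n * (starRingEnd ℂ) (Y' n) =
      (X n - X' n) * (starRingEnd ℂ) (Y n) + X' n * (starRingEnd ℂ) (Y n - Y' n) := by
      rw [map_sub]; ring
    rw [this]
    refine (norm_add_le _ _).trans ?_
    rw [norm_mul, norm_mul, RCLike.norm_conj, RCLike.norm_conj]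
    gcongr
    · exact mul_le_of_le_one_right (norm_nonneg _) (hG _)
    · exact ht2 _
  rw [Finset.sum_add_distrib, ← Finset.mul_sum, Finset.sum_sub_distrib] at h5
  have h6 := norm_le_norm_add_norm_sub' (∑ n ∈ Finset.range N, X n * (starRingEnd ℂ) (Y n))
    (∑ n ∈ Finset.range N, X' n * (starRingEnd ℂ) (Y' n))
  have h2' : ∑ n ∈ Finset.range N, ‖X n - X' n‖ ≤ ε / 5 * N := h2
  have h3' : ∑ n ∈ Finset.range N, ‖Y n - Y' n‖ ≤ ε / 5 * N := h3
  linarith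

end MOPS

namespace MOPS

/-- number of multiples of `p` in `[0, N)` -/
def K (p N : ℕ) : ℕ := (N + p - 1) / p

lemma lt_K {p N k : ℕ} (hp : 0 < p) : k < K p N ↔ p * k < N := by
  unfold K
  rw [Nat.lt_iff_add_one_le, Nat.le_div_iff_mul_le hp]
  constructor
  · intro h; nlinarith [Nat.sub_le (N + p) 1, (by omega : N + p - 1 + 1 = N + p)]
  · intro h
    have : (k + 1) * p = p * k + p := by ring
    omega

lemma sum_multiples {E : Type*} [AddCommMonoid E] (h : ℕ → E) (p N : ℕ) (hp : 0 < p) :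
    ∑ n ∈ Finset.range N, (if p ∣ n then h n else 0) = ∑ k ∈ Finset.range (K p N), h (p * k) := by
  rw [← Finset.sum_filter]
  symm
  refine Finset.sum_nbij (fun k => p * k) ?_ ?_ ?_ (fun _ _ => rfl)
  · intro k hk
    rw [Finset.mem_range, lt_K hp] at hk
    simp [hk]
  · intro a _ b _ hab
    exact Nat.eq_of_mul_eq_mul_left hp hab
  · intro n hn
    simp only [Finset.coe_filter, Finset.mem_range, Set.mem_ofPred_eq] at hn
    obtain ⟨hn, k, rfl⟩ := hn
    exact ⟨k, by simpa [lt_K hp] using hn, rfl⟩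

lemma K_le (p N : ℕ) (hp : 0 < p) : (K p N : ℝ) ≤ N / p + 1 := by
  have hp' : (0 : ℝ) < p := by exact_mod_cast hp
  have : K p N * p ≤ N + p := by
    unfold K
    exact (Nat.div_mul_le_self _ _).trans (Nat.sub_le _ _)
  have : (K p N : ℝ) * p ≤ N + p := by exact_mod_cast this
  rw [← div_self hp'.ne', ← add_div, le_div_iff₀ hp']
  exact this

lemma le_K (p N : ℕ) (hp : 0 < p) : (N : ℝ) / p ≤ K p N := by
  have hp' : (0 : ℝ) < p := by exact_mod_cast hp
  rw [div_le_iff₀ hp']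
  have : ¬ (p * K p N < N) := by rw [← lt_K hp]; simp
  push Not at this
  have : (N : ℝ) ≤ p * K p N := by exact_mod_cast this
  linarith

lemma count_multiples (p N : ℕ) (hp : 0 < p) :
    ∑ n ∈ Finset.range N, (if p ∣ n then (1 : ℝ) else 0) = K p N := by
  rw [sum_multiples (fun _ => (1 : ℝ)) p N hp]; simp

/-- Turán-Kubilius for a fixed finite set of primes -/
lemma turan (S : Finset ℕ) (hS : ∀ p ∈ S, p.Prime) (N : ℕ) (A : ℝ)
    (hA : A = ∑ p ∈ S, (1 : ℝ) / p) :
    ∑ n ∈ Finset.range N, ((∑ p ∈ S, if p ∣ n then (1 : ℝ) else 0) - A) ^ 2 ≤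
      A * N + (S.card : ℝ) ^ 2 := by
  set ω : ℕ → ℝ := fun n => ∑ p ∈ S, if p ∣ n then (1 : ℝ) else 0 with hω
  have hA0 : 0 ≤ A := by rw [hA]; positivity
  have h1 : A * N ≤ ∑ n ∈ Finset.range N, ω n := by
    rw [hω, Finset.sum_comm, hA, Finset.sum_mul]
    refine Finset.sum_le_sum fun p hp => ?_
    rw [count_multiples p N (hS p hp).pos]
    refine le_trans (le_of_eq ?_) (le_K p N (hS p hp).pos)
    ring
  have h2 : ∑ n ∈ Finset.range N, ω n ^ 2 ≤ A ^ 2 * N + A * N + (S.card : ℝ) ^ 2 := by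
    have e : ∑ n ∈ Finset.range N, ω n ^ 2 = ∑ p ∈ S, ∑ q ∈ S, ∑ n ∈ Finset.range N,
        (if p ∣ n then (1 : ℝ) else 0) * (if q ∣ n then (1 : ℝ) else 0) := by
      simp only [hω, sq, Finset.sum_mul_sum]
      rw [Finset.sum_comm]
      refine Finset.sum_congr rfl fun p _ => ?_
      rw [Finset.sum_comm]
    rw [e]
    have e2 : A ^ 2 * N + A * N + (S.card : ℝ) ^ 2 = ∑ p ∈ S, ∑ q ∈ S,
        ((1 : ℝ) / p * (1 / q) * N + (if p = q then (1 : ℝ) / p * N else 0) + 1) := by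
      simp only [Finset.sum_add_distrib, ← Finset.sum_mul]
      rw [← Finset.sum_mul_sum, ← hA]
      have : ∀ p ∈ S, (∑ q ∈ S, if p = q then (1 : ℝ) / p * N else 0) = 1 / p * N := by
        intro p hp
        rw [Finset.sum_ite_eq, if_pos hp]
      rw [Finset.sum_congr rfl this, ← Finset.sum_mul, ← hA]
      simp
      ring
    rw [e2]
    refine Finset.sum_le_sum fun p hp => Finset.sum_le_sum fun q hq => ?_
    have hpp := (hS p hp)
    have hqq := (hS q hq)
    by_cases hpq : p = q
    · subst hpq
      simp only [if_true]
      have : ∀ n, (if p ∣ n then (1 : ℝ) else 0) * (if p ∣ n then (1 : ℝ) else 0) =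
        if p ∣ n then (1 : ℝ) else 0 := by intro n; split_ifs <;> simp
      simp only [this]
      rw [count_multiples p N hpp.pos]
      have := K_le p N hpp.pos
      have h3 : (0 : ℝ) ≤ 1 / p * (1 / p) * N := by positivity
      have h4 : (1 : ℝ) / p * N = N / p := by ring
      linarith
    · simp only [hpq, if_false]
      have : ∀ n, (if p ∣ n then (1 : ℝ) else 0) * (if q ∣ n then (1 : ℝ) else 0) =
        if p * q ∣ n then (1 : ℝ) else 0 := by
        intro n
        have hco : Nat.Coprime p q := (Nat.coprime_primes hpp hqq).2 hpq
        have hiff : p * q ∣ n ↔ p ∣ n ∧ q ∣ n :=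
          ⟨fun h => ⟨(dvd_mul_right p q).trans h, (dvd_mul_left q p).trans h⟩,
            fun h => hco.mul_dvd_of_dvd_of_dvd h.1 h.2⟩
        by_cases h1 : p ∣ n <;> by_cases h2 : q ∣ n <;> simp [hiff, h1, h2]
      simp only [this]
      rw [count_multiples _ N (Nat.mul_pos hpp.pos hqq.pos)]
      have := K_le (p * q) N (Nat.mul_pos hpp.pos hqq.pos)
      have h4 : (1 : ℝ) / p * (1 / q) * N = N / ((p * q : ℕ) : ℝ) := by
        push_cast
        field_simp
      linarith
  have e : ∑ n ∈ Finset.range N, (ω n - A) ^ 2 =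
      ∑ n ∈ Finset.range N, ω n ^ 2 - 2 * A * ∑ n ∈ Finset.range N, ω n + A ^ 2 * N := by
    have : ∀ n, (ω n - A) ^ 2 = ω n ^ 2 - 2 * A * ω n + A ^ 2 := fun n => by ring
    simp only [this, Finset.sum_add_distrib, Finset.sum_sub_distrib, ← Finset.mul_sum]
    simp [mul_comm]
  rw [e]
  nlinarith

/-- Cauchy-Schwarz for one block of primes -/
lemma block (Q : Finset ℕ) (k : ℕ → ℕ) (M : ℕ) (hk : ∀ p ∈ Q, k p ≤ M) (w F : ℕ → ℂ)
    (hw : ∀ p, ‖w p‖ ≤ 1) (hF : ∀ p, ‖F p‖ ≤ 1) (v : ℕ → ℕ → ℂ) (hv : ∀ p n, ‖v p n‖ ≤ 1)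
    (ε C : ℝ) (hε : 0 ≤ ε)
    (hC : 0 ≤ C) (H : ∀ p ∈ Q, ∀ q ∈ Q, p ≠ q → ∀ n, ‖∑ i ∈ Finset.range n,
      v p i * (starRingEnd ℂ) (v q i)‖ ≤ ε * n + C) :
    ‖∑ p ∈ Q, ∑ i ∈ Finset.range (k p), w p * F i * v p i‖ ^ 2 ≤
      M * (Q.card * M + (Q.card : ℝ) ^ 2 * (ε * M + C)) := by
  set b : ℕ → ℂ := fun i => ∑ p ∈ Q, if i < k p then w p * v p i else 0 with hb
  have e1 : ∑ p ∈ Q, ∑ i ∈ Finset.range (k p), w p * F i * v p i =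
      ∑ i ∈ Finset.range M, F i * b i := by
    simp only [hb, Finset.mul_sum]
    rw [Finset.sum_comm]
    refine Finset.sum_congr rfl fun p hp => ?_
    have : Finset.range (k p) = (Finset.range M).filter (fun i => i < k p) := by
      ext i
      have := hk p hp
      simp only [Finset.mem_range, Finset.mem_filter]
      omega
    rw [this, Finset.sum_filter]
    refine Finset.sum_congr rfl fun i _ => ?_
    split_ifs
    · ring
    · simp
  rw [e1]
  have cs : ‖∑ i ∈ Finset.range M, F i * b i‖ ^ 2 ≤ M * ∑ i ∈ Finset.range M, ‖b i‖ ^ 2 := by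
    calc _ ≤ (∑ i ∈ Finset.range M, ‖b i‖) ^ 2 := by
          gcongr
          refine norm_sum_le_of_le _ fun i _ => ?_
          rw [norm_mul]
          exact mul_le_of_le_one_left (norm_nonneg _) (hF i)
      _ ≤ _ := by
          have := sq_sum_le_card_mul_sum_sq (s := Finset.range M) (f := fun i => ‖b i‖)
          simpa using this
  refine cs.trans ?_
  gcongr
  have e2 : ((∑ i ∈ Finset.range M, ‖b i‖ ^ 2 : ℝ) : ℂ) = ∑ p ∈ Q, ∑ q ∈ Q,
      w p * (starRingEnd ℂ) (w q) * ∑ i ∈ Finset.range (min (k p) (k q)),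
        v p i * (starRingEnd ℂ) (v q i) := by
    push_cast
    calc _ = ∑ i ∈ Finset.range M, ∑ p ∈ Q, ∑ q ∈ Q,
          (if i < k p then w p * v p i else 0) *
            (starRingEnd ℂ) (if i < k q then w q * v q i else 0) := by
          refine Finset.sum_congr rfl fun i _ => ?_
          rw [← Complex.mul_conj', hb, map_sum, Finset.sum_mul_sum]
      _ = _ := by
          rw [Finset.sum_comm]
          refine Finset.sum_congr rfl fun p hp => ?_
          rw [Finset.sum_comm]
          refine Finset.sum_congr rfl fun q hq => ?_
          have : Finset.range (min (k p) (k q)) =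
              (Finset.range M).filter (fun i => i < k p ∧ i < k q) := by
            ext i
            have := hk p hp
            simp only [Finset.mem_range, Finset.mem_filter]
            omega
          rw [this, Finset.sum_filter, Finset.mul_sum]
          refine Finset.sum_congr rfl fun i _ => ?_
          by_cases h1 : i < k p <;> by_cases h2 : i < k q <;> simp [h1, h2]
          ring
  have h0 : ∑ i ∈ Finset.range M, ‖b i‖ ^ 2 = ‖((∑ i ∈ Finset.range M, ‖b i‖ ^ 2 : ℝ) : ℂ)‖ := by
    rw [Complex.norm_real, Real.norm_eq_abs, abs_of_nonneg]
    positivity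
  rw [h0, e2]
  have e3 : (Q.card : ℝ) * M + (Q.card : ℝ) ^ 2 * (ε * M + C) =
      ∑ p ∈ Q, ∑ q ∈ Q, ((if p = q then (M : ℝ) else 0) + (ε * M + C)) := by
    simp only [Finset.sum_add_distrib]
    have : ∀ p ∈ Q, (∑ q ∈ Q, if p = q then (M : ℝ) else 0) = M := by
      intro p hp
      rw [Finset.sum_ite_eq, if_pos hp]
    rw [Finset.sum_congr rfl this]
    simp
    ring
  rw [e3]
  refine norm_sum_le_of_le _ fun p hp => norm_sum_le_of_le _ fun q hq => ?_
  rw [norm_mul, norm_mul, RCLike.norm_conj]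
  refine (mul_le_of_le_one_left (norm_nonneg _)
    (mul_le_one₀ (hw p) (norm_nonneg _) (hw q))).trans ?_
  have hmin : ((min (k p) (k q) : ℕ) : ℝ) ≤ M := by
    exact_mod_cast (min_le_left _ _).trans (hk p hp)
  by_cases hpq : p = q
  · simp only [hpq, if_true]
    have : ‖∑ i ∈ Finset.range (min (k q) (k q)), v q i * (starRingEnd ℂ) (v q i)‖ ≤
        ∑ i ∈ Finset.range (min (k q) (k q)), 1 := by
      push_cast
      refine norm_sum_le_of_le _ fun i _ => ?_
      rw [norm_mul, RCLike.norm_conj]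
      exact mul_le_one₀ (hv _ _) (norm_nonneg _) (hv _ _)
    subst hpq
    simp only [Finset.sum_const, Finset.card_range, nsmul_eq_mul, mul_one] at this
    have h5 : 0 ≤ ε * M + C := by positivity
    linarith
  · simp only [hpq, if_false, zero_add]
    refine (H p hp q hq hpq _).trans ?_
    gcongr

end MOPS

namespace MOPS

lemma pair_const (g : ℕ → ℂ) (hg : ∀ n, ‖g n‖ ≤ 1) (ε : ℝ) (hε : 0 < ε) (Q : Finset ℕ)
    (H : ∀ p ∈ Q, ∀ q ∈ Q, p ≠ q → ∀ᶠ N : ℕ in atTop,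
      ‖∑ n ∈ Finset.range N, g (p * n) * (starRingEnd ℂ) (g (q * n))‖ ≤ ε * N) :
    ∃ C : ℝ, 0 ≤ C ∧ ∀ p ∈ Q, ∀ q ∈ Q, p ≠ q → ∀ N : ℕ,
      ‖∑ n ∈ Finset.range N, g (p * n) * (starRingEnd ℂ) (g (q * n))‖ ≤ ε * N + C := by
  have h1 : ∀ p q : ℕ, ∃ C : ℕ, p ∈ Q → q ∈ Q → p ≠ q → ∀ N : ℕ,
      ‖∑ n ∈ Finset.range N, g (p * n) * (starRingEnd ℂ) (g (q * n))‖ ≤ ε * N + C := by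
    intro p q
    by_cases h : p ∈ Q ∧ q ∈ Q ∧ p ≠ q
    · obtain ⟨N0, hN0⟩ := eventually_atTop.1 (H p h.1 q h.2.1 h.2.2)
      refine ⟨N0, fun _ _ _ N => ?_⟩
      by_cases hN : N0 ≤ N
      · have h0 : (0 : ℝ) ≤ N0 := by positivity
        linarith [hN0 N hN]
      · have h2 : ‖∑ n ∈ Finset.range N, g (p * n) * (starRingEnd ℂ) (g (q * n))‖ ≤
            ∑ n ∈ Finset.range N, (1 : ℝ) := by
          refine norm_sum_le_of_le _ fun i _ => ?_
          rw [norm_mul, RCLike.norm_conj]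
          exact mul_le_one₀ (hg _) (norm_nonneg _) (hg _)
        simp only [Finset.sum_const, Finset.card_range, nsmul_eq_mul, mul_one] at h2
        have h3 : (N : ℝ) ≤ N0 := by exact_mod_cast (not_le.1 hN).le
        have h4 : 0 ≤ ε * N := by positivity
        linarith
    · exact ⟨0, fun a b c => absurd ⟨a, b, c⟩ h⟩
  choose C hC using h1
  refine ⟨∑ p ∈ Q, ∑ q ∈ Q, (C p q : ℝ), by positivity, fun p hp q hq hpq N => ?_⟩
  refine (hC p q hp hq hpq N).trans ?_
  gcongr
  calc (C p q : ℝ) ≤ ∑ q ∈ Q, (C p q : ℝ) :=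
        Finset.single_le_sum (f := fun q => (C p q : ℝ)) (fun _ _ => by positivity) hq
    _ ≤ _ := Finset.single_le_sum (f := fun p => ∑ q ∈ Q, (C p q : ℝ))
        (fun _ _ => by positivity) hp

lemma K_mono_bound (p j N : ℕ) (h : 2 ^ j ≤ p) : K p N ≤ N / 2 ^ j + 1 := by
  have h2 : 0 < 2 ^ j := by positivity
  have hp : 0 < p := lt_of_lt_of_le h2 h
  have h1 : K p N ≤ N / p + 1 := by
    unfold K
    rw [← Nat.add_div_right _ hp]
    exact Nat.div_le_div_right (by omega)
  have : N / p ≤ N / 2 ^ j := Nat.div_le_div_left h h2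
  omega

lemma block_bound (f g : ℕ → ℂ) (hf : ∀ n, ‖f n‖ ≤ 1) (hg : ∀ n, ‖g n‖ ≤ 1)
    (ε : ℝ) (hε : 0 < ε) (Q : Finset ℕ) (j : ℕ) (hQ : ∀ p ∈ Q, 2 ^ j ≤ p ∧ p < 2 ^ (j + 1))
    (H : ∀ p ∈ Q, ∀ q ∈ Q, p ≠ q → ∀ᶠ N : ℕ in atTop,
      ‖∑ n ∈ Finset.range N, g (p * n) * (starRingEnd ℂ) (g (q * n))‖ ≤ ε * N) :
    ∃ D : ℝ, 0 ≤ D ∧ ∀ N : ℕ, 1 ≤ N →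
      ‖∑ p ∈ Q, ∑ k ∈ Finset.range (K p N), f p * f k * g (p * k)‖ ≤
        N * (√(1 / 2) ^ j + 2 * √ε * ∑ p ∈ Q, (1 : ℝ) / p) + D * √N := by
  obtain ⟨C, hC0, hC⟩ := pair_const g hg ε hε Q H
  set s : ℝ := (Q.card : ℝ) with hs
  have hs0 : 0 ≤ s := by positivity
  set A : ℝ := ∑ p ∈ Q, (1 : ℝ) / p with hA
  have hA0 : 0 ≤ A := by positivity
  set r : ℝ := √(1 / 2) ^ j with hr
  have hr0 : 0 ≤ r := by positivity
  set x : ℝ := (1 / 2) ^ j with hx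
  have hx0 : 0 < x := by positivity
  have hx1 : x ≤ 1 := pow_le_one₀ (by norm_num) (by norm_num)
  have hrx : r ^ 2 = x := by
    rw [hr, hx, ← pow_mul, mul_comm, pow_mul, Real.sq_sqrt (by norm_num)]
  have hx2 : x * 2 ^ j = 1 := by
    rw [hx, ← mul_pow]; norm_num
  have hsx : x * s ≤ 1 := by
    have : Q.card ≤ 2 ^ j := by
      have : Q ⊆ Finset.Ico (2 ^ j) (2 ^ (j + 1)) := fun p hp => by
        simpa using hQ p hp
      refine (Finset.card_le_card this).trans ?_
      simp [pow_succ]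
      omega
    have : s ≤ 2 ^ j := by rw [hs]; exact_mod_cast this
    rw [← hx2]
    gcongr
  have hsA : x * s ≤ 2 * A := by
    have : ∑ p ∈ Q, x / 2 ≤ A := by
      refine Finset.sum_le_sum fun p hp => ?_
      have h1 := hQ p hp
      have hp0 : 0 < p := lt_of_lt_of_le (by positivity) h1.1
      have hp : (0 : ℝ) < p := by exact_mod_cast hp0
      have h3 : (p : ℝ) ≤ 2 ^ j * 2 := by
        have := h1.2.le
        rw [pow_succ] at this
        exact_mod_cast this
      rw [le_div_iff₀ hp]
      nlinarith
    simp only [Finset.sum_const, nsmul_eq_mul] at this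
    linarith
  set E : ℝ := s + ε * s ^ 2 with hE
  have hE0 : 0 ≤ E := by positivity
  refine ⟨√(3 * E + 2 * s ^ 2 * C), Real.sqrt_nonneg _, fun N hN => ?_⟩
  have hN1 : (1 : ℝ) ≤ N := by exact_mod_cast hN
  set M : ℕ := N / 2 ^ j + 1 with hM
  have hMx : (M : ℝ) ≤ N * x + 1 := by
    rw [hM]
    push_cast
    have : ((N / 2 ^ j : ℕ) : ℝ) ≤ N / ((2 ^ j : ℕ) : ℝ) := Nat.cast_div_le
    have h2 : (N : ℝ) / ((2 ^ j : ℕ) : ℝ) = N * x := by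
      rw [hx]; push_cast; rw [div_eq_mul_inv, one_div, inv_pow]
    linarith
  have hM0 : (0 : ℝ) ≤ M := by positivity
  have hb := block Q (fun p => K p N) M (fun p hp => K_mono_bound p j N (hQ p hp).1) f f hf hf
    (fun p i => g (p * i)) (fun p i => hg _) ε C hε.le hC0 hC
  set T : ℝ := ‖∑ p ∈ Q, ∑ k ∈ Finset.range (K p N), f p * f k * g (p * k)‖ with hT
  have hM2 : (M : ℝ) ^ 2 ≤ N ^ 2 * x ^ 2 + 3 * N := by
    have : (M : ℝ) ^ 2 ≤ (N * x + 1) ^ 2 := by gcongr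
    nlinarith
  have hM1 : (M : ℝ) ≤ 2 * N := by nlinarith
  set D := 3 * E + 2 * s ^ 2 * C with hD
  have hD0 : 0 ≤ D := by positivity
  have h1 : T ^ 2 ≤ N ^ 2 * (x ^ 2 * E) + D * N := by
    have e1 : (M : ℝ) * (s * M + s ^ 2 * (ε * M + C)) = E * M ^ 2 + s ^ 2 * C * M := by
      rw [hE]; ring
    have h2 : E * (M : ℝ) ^ 2 ≤ E * (N ^ 2 * x ^ 2 + 3 * N) := by gcongr
    have h3 : s ^ 2 * C * M ≤ s ^ 2 * C * (2 * N) := by gcongr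
    rw [e1] at hb
    refine hb.trans ((add_le_add h2 h3).trans (le_of_eq ?_))
    rw [hD]; ring
  have h2 : x ^ 2 * E ≤ r ^ 2 + (2 * √ε * A) ^ 2 := by
    have e1 : x ^ 2 * E = x * (x * s) + ε * (x * s) ^ 2 := by rw [hE]; ring
    have e2 : (2 * √ε * A) ^ 2 = ε * (2 * A) ^ 2 := by
      rw [mul_pow, mul_pow, Real.sq_sqrt hε.le]; ring
    rw [e1, e2, hrx]
    have : x * (x * s) ≤ x * 1 := by gcongr
    have : ε * (x * s) ^ 2 ≤ ε * (2 * A) ^ 2 := by gcongr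
    linarith
  have h3 : T ^ 2 ≤ (N * (r + 2 * √ε * A) + √D * √N) ^ 2 := by
    have e1 : D * N = (√D * √N) ^ 2 := by
      rw [mul_pow, Real.sq_sqrt hD0, Real.sq_sqrt (by positivity)]
    have h4 : (N : ℝ) ^ 2 * (x ^ 2 * E) ≤ N ^ 2 * (r ^ 2 + (2 * √ε * A) ^ 2) := by gcongr
    have h5 : (0 : ℝ) ≤ N ^ 2 * (2 * r * (2 * √ε * A)) := by positivity
    have h6 : (0 : ℝ) ≤ 2 * (N * (r + 2 * √ε * A)) * (√D * √N) := by positivity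
    nlinarith
  exact (pow_le_pow_iff_left₀ (norm_nonneg _) (by positivity) two_ne_zero).1 h3

lemma mult_error (f g : ℕ → ℂ) (hf : ∀ n, ‖f n‖ ≤ 1) (hg : ∀ n, ‖g n‖ ≤ 1)
    (hmult : ∀ a b : ℕ, Nat.Coprime a b → f (a * b) = f a * f b) (p : ℕ) (hp : p.Prime)
    (ε : ℝ) (hpε : 1 / (p : ℝ) ≤ ε) (N : ℕ) :
    ‖∑ k ∈ Finset.range (K p N), f (p * k) * g (p * k) -
      ∑ k ∈ Finset.range (K p N), f p * f k * g (p * k)‖ ≤ 2 * (ε * N * (1 / p) + 2) := by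
  have hp0 : (0 : ℝ) < p := by exact_mod_cast hp.pos
  have hp1 : (1 : ℝ) ≤ p := by exact_mod_cast hp.one_lt.le
  rw [← Finset.sum_sub_distrib]
  have h1 : ‖∑ k ∈ Finset.range (K p N), (f (p * k) * g (p * k) - f p * f k * g (p * k))‖ ≤
      ∑ k ∈ Finset.range (K p N), 2 * (if p ∣ k then (1 : ℝ) else 0) := by
    refine norm_sum_le_of_le _ fun k _ => ?_
    split_ifs with h
    · have a1 : ‖f (p * k) * g (p * k)‖ ≤ 1 := by
        rw [norm_mul]; exact mul_le_one₀ (hf _) (norm_nonneg _) (hg _)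
      have a2 : ‖f p * f k * g (p * k)‖ ≤ 1 := by
        rw [norm_mul, norm_mul]
        exact mul_le_one₀ (mul_le_one₀ (hf _) (norm_nonneg _) (hf _)) (norm_nonneg _) (hg _)
      linarith [norm_sub_le (f (p * k) * g (p * k)) (f p * f k * g (p * k))]
    · rw [hmult p k ((Nat.Prime.coprime_iff_not_dvd hp).2 h)]
      simp
  refine h1.trans ?_
  rw [← Finset.mul_sum, count_multiples p _ hp.pos]
  gcongr
  refine (K_le p _ hp.pos).trans ?_
  have h2 := K_le p N hp.pos
  have h3 : (K p N : ℝ) / p ≤ (N / p + 1) / p := by gcongr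
  have h4 : ((N : ℝ) / p + 1) / p = 1 / p * N * (1 / p) + 1 / p := by field_simp
  have h5 : 1 / (p : ℝ) * N * (1 / p) ≤ ε * N * (1 / p) := by gcongr
  have h6 : 1 / (p : ℝ) ≤ 1 := by rw [div_le_one hp0]; exact hp1
  linarith

lemma geom_bound (J : Finset ℕ) : ∑ j ∈ J, √(1 / 2) ^ j ≤ 4 := by
  have h1 : √(1 / 2) ≤ 3 / 4 := by
    rw [Real.sqrt_le_left (by norm_num)]; norm_num
  have h0 : 0 ≤ √(1 / 2 : ℝ) := Real.sqrt_nonneg _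
  refine ((summable_geometric_of_lt_one h0 (by linarith)).sum_le_tsum J
    (fun _ _ => by positivity)).trans ?_
  rw [tsum_geometric_of_lt_one h0 (by linarith)]
  rw [inv_le_comm₀ (by linarith) (by norm_num)]
  linarith

lemma S_bound (f g : ℕ → ℂ) (hf : ∀ n, ‖f n‖ ≤ 1) (hg : ∀ n, ‖g n‖ ≤ 1)
    (ε : ℝ) (hε : 0 < ε) (S : Finset ℕ) (hS : ∀ p ∈ S, p.Prime)
    (H : ∀ p ∈ S, ∀ q ∈ S, p ≠ q → ∀ᶠ N : ℕ in atTop,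
      ‖∑ n ∈ Finset.range N, g (p * n) * (starRingEnd ℂ) (g (q * n))‖ ≤ ε * N) :
    ∃ D : ℝ, 0 ≤ D ∧ ∀ N : ℕ, 1 ≤ N →
      ‖∑ p ∈ S, ∑ k ∈ Finset.range (K p N), f p * f k * g (p * k)‖ ≤
        N * (4 + 2 * √ε * ∑ p ∈ S, (1 : ℝ) / p) + D * √N := by
  have hb : ∀ j, ∃ D : ℝ, 0 ≤ D ∧ ∀ N : ℕ, 1 ≤ N →
      ‖∑ p ∈ S with Nat.log 2 p = j, ∑ k ∈ Finset.range (K p N), f p * f k * g (p * k)‖ ≤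
        N * (√(1 / 2) ^ j + 2 * √ε * ∑ p ∈ S with Nat.log 2 p = j, (1 : ℝ) / p) + D * √N := by
    intro j
    refine block_bound f g hf hg ε hε _ j ?_ ?_
    · intro p hp
      rw [Finset.mem_filter] at hp
      have := (Nat.log_eq_iff (b := 2) (m := j) (n := p)
        (Or.inr ⟨by norm_num, (hS p hp.1).ne_zero⟩)).1 hp.2
      exact this
    · intro p hp q hq
      exact H p (Finset.mem_filter.1 hp).1 q (Finset.mem_filter.1 hq).1
  choose D hD0 hD using hb
  set J := S.image (Nat.log 2) with hJ
  have hm : ∀ p ∈ S, Nat.log 2 p ∈ J := fun p hp => Finset.mem_image_of_mem _ hp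
  refine ⟨∑ j ∈ J, D j, Finset.sum_nonneg fun j _ => hD0 j, fun N hN => ?_⟩
  rw [← Finset.sum_fiberwise_of_maps_to hm, ← Finset.sum_fiberwise_of_maps_to hm
    (fun p : ℕ => (1 : ℝ) / p)]
  refine (norm_sum_le_of_le _ fun j _ => hD j N hN).trans ?_
  rw [Finset.sum_add_distrib, ← Finset.mul_sum, Finset.sum_add_distrib, ← Finset.mul_sum,
    ← Finset.sum_mul]
  gcongr
  exact geom_bound J

end MOPS

namespace MOPS

lemma turan_abs (S : Finset ℕ) (hS : ∀ p ∈ S, p.Prime) (N : ℕ) (A : ℝ)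
    (hA : A = ∑ p ∈ S, (1 : ℝ) / p) :
    ∑ n ∈ Finset.range N, |(∑ p ∈ S, if p ∣ n then (1 : ℝ) else 0) - A| ≤
      √A * N + S.card * √N := by
  have hA0 : 0 ≤ A := by rw [hA]; positivity
  have h1 := turan S hS N A hA
  have h2 := sq_sum_le_card_mul_sum_sq (s := Finset.range N)
    (f := fun n => |(∑ p ∈ S, if p ∣ n then (1 : ℝ) else 0) - A|)
  simp only [sq_abs, Finset.card_range] at h2
  have h3 : (N : ℝ) * ∑ n ∈ Finset.range N, ((∑ p ∈ S, if p ∣ n then (1 : ℝ) else 0) - A) ^ 2 ≤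
      N * (A * N + (S.card : ℝ) ^ 2) := by gcongr
  have h4 : (N : ℝ) * (A * N + (S.card : ℝ) ^ 2) ≤ (√A * N + S.card * √N) ^ 2 := by
    have e1 : (√A * N + S.card * √N) ^ 2 = (√A) ^ 2 * N ^ 2 + (S.card : ℝ) ^ 2 * (√N) ^ 2 +
      2 * (√A * N) * (S.card * √N) := by ring
    rw [e1, Real.sq_sqrt hA0, Real.sq_sqrt (by positivity)]
    have : 0 ≤ 2 * (√A * N) * (S.card * √N) := by positivity
    linarith
  exact (pow_le_pow_iff_left₀ (Finset.sum_nonneg fun _ _ => abs_nonneg _) (by positivity)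
    two_ne_zero).1 (h2.trans (h3.trans h4))

lemma katai_bound (f g : ℕ → ℂ) (hf : ∀ n, ‖f n‖ ≤ 1) (hg : ∀ n, ‖g n‖ ≤ 1)
    (hmult : ∀ a b : ℕ, Nat.Coprime a b → f (a * b) = f a * f b)
    (ε : ℝ) (hε : 0 < ε) (S : Finset ℕ) (hS : ∀ p ∈ S, p.Prime)
    (hSε : ∀ p ∈ S, 1 / (p : ℝ) ≤ ε) (A : ℝ) (hA : A = ∑ p ∈ S, (1 : ℝ) / p)
    (H : ∀ p ∈ S, ∀ q ∈ S, p ≠ q → ∀ᶠ N : ℕ in atTop,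
      ‖∑ n ∈ Finset.range N, g (p * n) * (starRingEnd ℂ) (g (q * n))‖ ≤ ε * N) :
    ∃ D : ℝ, 0 ≤ D ∧ ∀ N : ℕ, 1 ≤ N →
      A * ‖∑ n ∈ Finset.range N, f n * g n‖ ≤
        N * (√A + 2 * ε * A + 4 + 2 * √ε * A) + D * √N := by
  obtain ⟨D, hD0, hD⟩ := S_bound f g hf hg ε hε S hS H
  have hA0 : 0 ≤ A := by rw [hA]; positivity
  refine ⟨D + S.card + 4 * S.card, by positivity, fun N hN => ?_⟩
  have hN1 : (1 : ℝ) ≤ N := by exact_mod_cast hN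
  have hsN : 1 ≤ √(N : ℝ) := by rw [Real.one_le_sqrt]; exact hN1
  set ω : ℕ → ℝ := fun n => ∑ p ∈ S, if p ∣ n then (1 : ℝ) else 0 with hω
  have e1 : (A : ℂ) * ∑ n ∈ Finset.range N, f n * g n =
      -(∑ n ∈ Finset.range N, ((ω n - A : ℝ) : ℂ) * (f n * g n)) +
      (∑ n ∈ Finset.range N, ((ω n : ℝ) : ℂ) * (f n * g n)) := by
    rw [Finset.mul_sum, ← Finset.sum_neg_distrib, ← Finset.sum_add_distrib]
    refine Finset.sum_congr rfl fun n _ => ?_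
    push_cast; ring
  have e2 : ∑ n ∈ Finset.range N, ((ω n : ℝ) : ℂ) * (f n * g n) =
      ∑ p ∈ S, ∑ k ∈ Finset.range (K p N), f (p * k) * g (p * k) := by
    simp only [hω, Complex.ofReal_sum, Finset.sum_mul]
    rw [Finset.sum_comm]
    refine Finset.sum_congr rfl fun p hp => ?_
    rw [← sum_multiples (fun n => f n * g n) p N (hS p hp).pos]
    refine Finset.sum_congr rfl fun n _ => ?_
    split_ifs <;> simp
  have b1 : ‖∑ n ∈ Finset.range N, ((ω n - A : ℝ) : ℂ) * (f n * g n)‖ ≤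
      √A * N + S.card * √N := by
    refine (norm_sum_le_of_le _ fun n _ => ?_).trans (turan_abs S hS N A hA)
    rw [norm_mul, norm_mul, Complex.norm_real, Real.norm_eq_abs]
    exact mul_le_of_le_one_right (abs_nonneg _) (mul_le_one₀ (hf _) (norm_nonneg _) (hg _))
  have b2 : ‖∑ p ∈ S, ∑ k ∈ Finset.range (K p N), f (p * k) * g (p * k) -
      ∑ p ∈ S, ∑ k ∈ Finset.range (K p N), f p * f k * g (p * k)‖ ≤
      2 * ε * A * N + 4 * S.card := by
    rw [← Finset.sum_sub_distrib]
    refine (norm_sum_le_of_le _ fun p hp =>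
      mult_error f g hf hg hmult p (hS p hp) ε (hSε p hp) N).trans (le_of_eq ?_)
    rw [← Finset.mul_sum, Finset.sum_add_distrib, ← Finset.mul_sum, ← hA]
    simp
    ring
  have b3 := hD N hN
  rw [← hA] at b3
  have e3 : A * ‖∑ n ∈ Finset.range N, f n * g n‖ =
      ‖(A : ℂ) * ∑ n ∈ Finset.range N, f n * g n‖ := by
    rw [norm_mul, Complex.norm_real, Real.norm_eq_abs, abs_of_nonneg hA0]
  rw [e3, e1, e2]
  have b4 := norm_add_le (-(∑ n ∈ Finset.range N, ((ω n - A : ℝ) : ℂ) * (f n * g n)))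
    (∑ p ∈ S, ∑ k ∈ Finset.range (K p N), f (p * k) * g (p * k))
  rw [norm_neg] at b4
  have b5 := norm_sub_norm_le (∑ p ∈ S, ∑ k ∈ Finset.range (K p N), f (p * k) * g (p * k))
    (∑ p ∈ S, ∑ k ∈ Finset.range (K p N), f p * f k * g (p * k))
  have b6 : 4 * (S.card : ℝ) ≤ 4 * S.card * √N := by
    nlinarith [(by positivity : (0 : ℝ) ≤ S.card)]
  refine b4.trans ?_
  linarith

lemma exists_primes (P0 : ℕ) (B : ℝ) : ∃ S : Finset ℕ, (∀ p ∈ S, p.Prime ∧ P0 < p) ∧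
    B ≤ ∑ p ∈ S, (1 : ℝ) / p := by
  have h := (not_summable_iff_tendsto_nat_atTop_of_nonneg (f := fun n =>
    Set.indicator {p : ℕ | p.Prime} (fun n : ℕ => (1 : ℝ) / n) n) (fun n =>
      Set.indicator_nonneg (fun _ _ => by positivity) _)).1 not_summable_one_div_on_primes
  obtain ⟨n, hn⟩ := (h.eventually_ge_atTop (B + ∑ p ∈ Finset.range (P0 + 1),
    Set.indicator {p : ℕ | p.Prime} (fun n : ℕ => (1 : ℝ) / n) p)).exists
  refine ⟨(Finset.range n).filter (fun p => p.Prime ∧ P0 < p), fun p hp =>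
    (Finset.mem_filter.1 hp).2, ?_⟩
  have : ∑ p ∈ Finset.range n, Set.indicator {p : ℕ | p.Prime} (fun n : ℕ => (1 : ℝ) / n) p ≤
      ∑ p ∈ Finset.range (P0 + 1), Set.indicator {p : ℕ | p.Prime} (fun n : ℕ => (1 : ℝ) / n) p +
      ∑ p ∈ (Finset.range n).filter (fun p => p.Prime ∧ P0 < p), (1 : ℝ) / p := by
    have hnn : ∀ p : ℕ, 0 ≤ Set.indicator {p : ℕ | p.Prime} (fun n : ℕ => (1 : ℝ) / n) p :=
      fun n => Set.indicator_nonneg (fun _ _ => by positivity) _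
    rw [← Finset.sum_filter_add_sum_filter_not (Finset.range n) (fun p => p < P0 + 1)]
    refine add_le_add ?_ ?_
    · refine Finset.sum_le_sum_of_subset_of_nonneg ?_ fun p _ _ => hnn p
      intro p hp
      simp only [Finset.mem_filter] at hp
      simpa using hp.2
    · rw [Finset.sum_filter, Finset.sum_filter]
      refine Finset.sum_le_sum fun p _ => ?_
      by_cases hp : p.Prime <;> by_cases h2 : P0 < p <;>
        simp [hp, h2, Set.indicator, Nat.lt_succ_iff]
  linarith

lemma katai (f g : ℕ → ℂ) (hf : ∀ n, ‖f n‖ ≤ 1) (hg : ∀ n, ‖g n‖ ≤ 1)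
    (hmult : ∀ a b : ℕ, Nat.Coprime a b → f (a * b) = f a * f b)
    (H : ∀ ε : ℝ, 0 < ε → ε ≤ 1 → ∃ P0 : ℕ, ∀ p q : ℕ, p.Prime → q.Prime → p ≠ q → P0 < p →
      P0 < q → ∀ᶠ N : ℕ in atTop,
      ‖∑ n ∈ Finset.range N, g (p * n) * (starRingEnd ℂ) (g (q * n))‖ ≤ ε * N) :
    Tendsto (fun N : ℕ => (∑ n ∈ Finset.range N, f n * g n) / N) atTop (nhds 0) := by
  have key : ∀ δ : ℝ, 0 < δ → δ ≤ 1 → ∀ᶠ N : ℕ in atTop,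
      ‖∑ n ∈ Finset.range N, f n * g n‖ ≤ δ * N := by
    intro δ hδ hδ1
    set ε : ℝ := (δ / 16) ^ 2 with hε
    have hε0 : 0 < ε := by positivity
    have hε1 : ε ≤ 1 := pow_le_one₀ (by positivity) (by linarith)
    have hsε : √ε = δ / 16 := Real.sqrt_sq (by positivity)
    obtain ⟨P0, hP0⟩ := H ε hε0 hε1
    obtain ⟨P1, hP1⟩ := exists_nat_gt (1 / ε)
    obtain ⟨S, hS, hB⟩ := exists_primes (max P0 P1) (16 / δ ^ 2)
    set A : ℝ := ∑ p ∈ S, (1 : ℝ) / p with hA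
    obtain ⟨D, hD0, hD⟩ := katai_bound f g hf hg hmult ε hε0 S (fun p hp => (hS p hp).1)
      (fun p hp => by
        have h1 : P1 < p := lt_of_le_of_lt (le_max_right _ _) (hS p hp).2
        have h2 : 1 / ε < p := hP1.trans (by exact_mod_cast h1)
        have h3 : (0 : ℝ) < p := lt_trans (by positivity) h2
        rw [div_le_iff₀ h3]
        rw [div_lt_iff₀ hε0] at h2
        linarith) A hA
      (fun p hp q hq hpq => hP0 p q (hS p hp).1 (hS q hq).1 hpq
        (lt_of_le_of_lt (le_max_left _ _) (hS p hp).2)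
        (lt_of_le_of_lt (le_max_left _ _) (hS q hq).2))
    have hAδ : 16 ≤ A * δ ^ 2 := by
      rwa [div_le_iff₀ (by positivity)] at hB
    have hA0 : 0 < A := lt_of_lt_of_le (by positivity) hB
    have hsA : 4 ≤ √A * δ := by
      have : √(16 : ℝ) ≤ √(A * δ ^ 2) := Real.sqrt_le_sqrt hAδ
      rw [Real.sqrt_mul hA0.le, Real.sqrt_sq hδ.le] at this
      have h16 : √(16 : ℝ) = 4 := by
        rw [show (16 : ℝ) = 4 ^ 2 by norm_num]; exact Real.sqrt_sq (by norm_num)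
      linarith
    have hb : √A + 2 * ε * A + 4 + 2 * √ε * A ≤ 3 / 4 * δ * A := by
      have h1 : √A ≤ A * δ / 4 := by
        have := Real.mul_self_sqrt hA0.le
        nlinarith [Real.sqrt_nonneg A]
      have hAd : A * δ ^ 2 ≤ A * δ := by
        have : δ ^ 2 ≤ δ := by nlinarith
        gcongr
      have h2 : 2 * ε * A = A * δ ^ 2 / 128 := by rw [hε]; ring
      have h3 : 2 * √ε * A = A * δ / 8 := by rw [hsε]; ring
      rw [h2, h3]
      have : 0 < A * δ := by positivity
      linarith
    obtain ⟨N0, hN0⟩ := exists_nat_gt ((4 * D / (δ * A)) ^ 2)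
    filter_upwards [eventually_ge_atTop N0, eventually_ge_atTop 1] with N hN hN1
    have h1 := hD N hN1
    have hNr : (0 : ℝ) ≤ N := by positivity
    have h2 : 4 * D / (δ * A) ≤ √N := by
      refine Real.le_sqrt_of_sq_le (hN0.le.trans ?_)
      exact_mod_cast hN
    rw [div_le_iff₀ (by positivity)] at h2
    have h3 : D * √N ≤ 1 / 4 * δ * A * N := by
      have h5 : √(N : ℝ) * √N = N := Real.mul_self_sqrt hNr
      have h6 := mul_le_mul_of_nonneg_right h2 (Real.sqrt_nonneg (N : ℝ))
      have h7 : √(N : ℝ) * (δ * A) * √N = δ * A * N := by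
        calc _ = δ * A * (√(N : ℝ) * √N) := by ring
          _ = _ := by rw [h5]
      linarith
    have h4 : (N : ℝ) * (√A + 2 * ε * A + 4 + 2 * √ε * A) ≤ N * (3 / 4 * δ * A) := by gcongr
    refine le_of_mul_le_mul_left (h1.trans ?_) hA0
    linarith
  rw [Metric.tendsto_nhds]
  intro η hη
  have hδ : 0 < min (η / 2) 1 := by positivity
  filter_upwards [key _ hδ (min_le_right _ _), eventually_ge_atTop 1] with N hN hN1
  have hNr : (0 : ℝ) < N := by exact_mod_cast hN1
  rw [dist_zero_right, norm_div, Complex.norm_natCast, div_lt_iff₀ hNr]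
  have : min (η / 2) 1 * N ≤ η / 2 * N := by gcongr; exact min_le_left _ _
  have : 0 < η / 2 * N := by positivity
  linarith

end MOPS

theorem mult_orthogonality_piatetski_shapiro (m : ℕ) (hm : 2 ≤ m)
    (c : ℝ) (hc : 1 < c) (hcint : ∀ n : ℤ, c ≠ (n : ℝ))
    (G : ZMod m → ℂ) (f : ℕ → ℂ)
    (hmult : ∀ a b : ℕ, Nat.Coprime a b → f (a * b) = f a * f b)
    (hbound : ∀ n, ‖f n‖ ≤ 1)
    (hmean : Tendsto (fun N : ℕ => (∑ n ∈ Finset.range N, f n) / N) atTop (nhds 0)) :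
    Tendsto (fun N : ℕ =>
        (∑ n ∈ Finset.range N, f n * G ((⌊((n : ℕ) : ℝ) ^ c⌋ : ZMod m))) / N)
      atTop (nhds 0) := by
  haveI : NeZero m := ⟨by omega⟩
  have hm0 : (m : ℂ) ≠ 0 := by exact_mod_cast (NeZero.ne m)
  set μ : ℂ := (∑ x, G x) / m with hμ
  set B : ℝ := ∑ x, ‖G x - μ‖ + 1 with hB
  have hB0 : 0 < B := by positivity
  have hBc : (B : ℂ) ≠ 0 := by exact_mod_cast hB0.ne'
  set G' : ZMod m → ℂ := fun x => (G x - μ) / B with hG'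
  have h1 : ∀ x, ‖G' x‖ ≤ 1 := by
    intro x
    rw [hG', norm_div, Complex.norm_real, Real.norm_eq_abs, abs_of_pos hB0, div_le_one hB0, hB]
    have := Finset.single_le_sum (f := fun x => ‖G x - μ‖) (fun _ _ => norm_nonneg _)
      (Finset.mem_univ x)
    linarith
  have h0 : ∑ x, G' x = 0 := by
    simp only [hG']
    rw [← Finset.sum_div, Finset.sum_sub_distrib]
    simp only [Finset.sum_const, Finset.card_univ, ZMod.card, nsmul_eq_mul]
    rw [hμ, mul_div_cancel₀ _ hm0, sub_self, zero_div]
  have hk := MOPS.katai f (fun n => G' ((⌊((n : ℕ) : ℝ) ^ c⌋ : ℤ) : ZMod m)) hbound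
    (fun n => h1 _) hmult (fun ε hε hε1 => MOPS.corr m G' c hc hcint h1 h0 ε hε hε1)
  have ht := (hk.const_mul (B : ℂ)).add (hmean.const_mul μ)
  simp only [mul_zero, add_zero] at ht
  refine ht.congr fun N => ?_
  rw [mul_div_assoc', mul_div_assoc', ← add_div, Finset.mul_sum, Finset.mul_sum,
    ← Finset.sum_add_distrib]
  congr 1
  refine Finset.sum_congr rfl fun n _ => ?_
  simp only [hG']
  field_simp
  ring
end
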